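/- arXiv:1906.04350 — 3 statements merged into one kernel-verified Lean document; each statement's English description precedes it below -/
import Mathlib

section
/- There exist universal constants C₄ > 5 and ε₃ > 0 such that the following holds. Let a ∈ Λ and m, ℓ ∈ ℤ with m ≥ ℓ ≥ 0. Let L be a nonempty subset of the upper edge of P^r_{a;m,ℓ}, and let u : P^r_{a;m,ℓ} → ℝ satisfy |u(b) + u(b-ξ) + u(b+η)| ≤ C₄^{-2ℓ}·min_{c ∈ L}|u(c)| for every b with {b, b-ξ, b+η} ⊂ P^r_{a;m,ℓ}. Then: if L = {a - ⌊m/2⌋ξ} or L = {a - ⌈m/2⌉ξ}, the number of points b ∈ P^r_{a;m,ℓ} with |u(b)| ≥ C₄^{-2ℓ}·min_{c ∈ L}|u(c)| is at least ε₃·(ℓ+1)²; and if L = {a - tξ : t ∈ ℤ, 1 ≤ t ≤ m-1} (assuming m ≥ 2), this number is at least ε₃·(m+2)·(ℓ+1). -/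
/-- The lattice vector `ξ = (-1, 0)` of the triangular lattice in `ℝ²`. -/
noncomputable def xiv : ℝ × ℝ := (-1, 0)

/-- The lattice vector `η = (1/2, √3/2)` of the triangular lattice in `ℝ²`. -/
noncomputable def etav : ℝ × ℝ := (1 / 2, Real.sqrt 3 / 2)

/-- The triangular lattice `Λ = {sξ + tη : s, t ∈ ℤ}`. -/
def Lam : Set (ℝ × ℝ) := {p | ∃ s t : ℤ, p = (s : ℝ) • xiv + (t : ℝ) • etav}

/-- The reversed trapezoid `P^r_{a;m,ℓ} = {a - tξ - sη : s ≤ t ≤ m, 0 ≤ s ≤ ℓ}`. -/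
def PrSet (a : ℝ × ℝ) (m l : ℕ) : Set (ℝ × ℝ) :=
  {p | ∃ s t : ℤ, 0 ≤ s ∧ s ≤ l ∧ s ≤ t ∧ t ≤ m ∧
    p = a - (t : ℝ) • xiv - (s : ℝ) • etav}

/-- The upper edge `{a - tξ : 0 ≤ t ≤ m}` of the reversed trapezoid. -/
def PrUpperEdge (a : ℝ × ℝ) (m : ℕ) : Set (ℝ × ℝ) :=
  {p | ∃ t : ℤ, 0 ≤ t ∧ t ≤ m ∧ p = a - (t : ℝ) • xiv}

open Finset

theorem factorial_card_le_prod_of_pos (U : Finset ℕ) (hU : ∀ x ∈ U, 0 < x) :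
    (#U).factorial ≤ ∏ x ∈ U, x := by
  induction U using Finset.induction_on_max with
  | empty => simp
  | insert a s hlt ih =>
    have ha : a ∉ s := fun h => (hlt a h).false
    rw [card_insert_of_notMem ha, prod_insert ha, Nat.factorial_succ]
    refine Nat.mul_le_mul ?_ (ih fun x hx => hU x (mem_insert_of_mem hx))
    have hsub : insert a s ⊆ Icc 1 a := by
      intro x hx
      rw [mem_Icc]
      refine ⟨hU x hx, ?_⟩
      rcases mem_insert.1 hx with rfl | h
      exacts [le_rfl, (hlt x h).le]
    simpa [card_insert_of_notMem ha] using card_le_card hsub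

theorem factorial_le_two_pow_mul_prod_sub (T : Finset ℕ) (i : ℕ) (hi : i ∉ T) :
    ((#T).factorial : ℝ) ≤ 2 ^ #T * ∏ l ∈ T, |(i : ℝ) - l| := by
  have h1 : (#(T.filter (· < i))).factorial ≤ ∏ l ∈ T.filter (· < i), (i - l) := by
    have hinj : Set.InjOn (fun l => i - l) (T.filter (· < i)) := by
      intro x hx y hy hxy
      simp only [coe_filter, Set.mem_ofPred_eq] at hx hy hxy
      omega
    have := factorial_card_le_prod_of_pos ((T.filter (· < i)).image (fun l => i - l)) (by
      simp only [mem_image, mem_filter]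
      rintro _ ⟨l, hl, rfl⟩
      omega)
    rwa [card_image_of_injOn hinj, prod_image hinj] at this
  have h2 : (#(T.filter (¬ · < i))).factorial ≤ ∏ l ∈ T.filter (¬ · < i), (l - i) := by
    have hinj : Set.InjOn (fun l => l - i) (T.filter (¬ · < i)) := by
      intro x hx y hy hxy
      simp only [coe_filter, Set.mem_ofPred_eq] at hx hy hxy
      omega
    have := factorial_card_le_prod_of_pos ((T.filter (¬ · < i)).image (fun l => l - i)) (by
      simp only [mem_image, mem_filter]
      rintro _ ⟨l, hl, rfl⟩
      have : l ≠ i := fun h => hi (h ▸ hl.1)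
      omega)
    rwa [card_image_of_injOn hinj, prod_image hinj] at this
  have hcard := card_filter_add_card_filter_not (s := T) (p := (· < i))
  have h3 : (#T).factorial ≤
      2 ^ #T * ((∏ l ∈ T.filter (· < i), (i - l)) * ∏ l ∈ T.filter (¬ · < i), (l - i)) := by
    have := Nat.add_choose_mul_factorial_mul_factorial
      #(T.filter (· < i)) #(T.filter (¬ · < i))
    rw [hcard] at this
    rw [← this, mul_assoc]
    exact Nat.mul_le_mul (Nat.choose_le_two_pow _ _) (Nat.mul_le_mul h1 h2)
  have h4 : ∏ l ∈ T, |(i : ℝ) - l| =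
      ((((∏ l ∈ T.filter (· < i), (i - l)) * ∏ l ∈ T.filter (¬ · < i), (l - i)) : ℕ) : ℝ) := by
    rw [← prod_filter_mul_prod_filter_not T (· < i)]
    push_cast
    congr 1
    · refine prod_congr rfl fun l hl => ?_
      have hl := (mem_filter.1 hl).2
      rw [Nat.cast_sub hl.le, abs_of_nonneg]
      have : (l : ℝ) ≤ i := by exact_mod_cast hl.le
      linarith
    · refine prod_congr rfl fun l hl => ?_
      have hl := not_lt.1 (mem_filter.1 hl).2
      have : (i : ℝ) ≤ l := by exact_mod_cast hl
      rw [Nat.cast_sub hl, abs_of_nonpos (by linarith)]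
      ring
  rw [h4]
  exact_mod_cast h3

theorem two_mul_pow_div_factorial_le (N k : ℕ) :
    (2 * (N : ℝ)) ^ k / (k.factorial : ℝ) ≤ 8 ^ N := by
  refine (Real.pow_div_factorial_le_exp _ (by positivity) k).trans ?_
  have h : Real.exp 2 ≤ 8 := by
    have h1 := Real.exp_one_lt_d9
    have h2 : Real.exp 2 = Real.exp 1 * Real.exp 1 := by rw [← Real.exp_add]; norm_num
    rw [h2]
    nlinarith [Real.exp_pos 1]
  calc Real.exp (2 * N) = Real.exp 2 ^ N := by rw [← Real.exp_nat_mul]; ring_nf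
    _ ≤ 8 ^ N := by gcongr

/-- A polynomial of degree less than `#T` is controlled on `{0, …, N}` by its values on a set `T`
of integers of this interval. -/
theorem abs_eval_le_of_abs_eval_le (P : Polynomial ℝ) (N : ℕ) (T : Finset ℕ)
    (hT : T ⊆ range (N + 1)) (hdeg : P.degree < #T) (M : ℝ) (hM0 : 0 ≤ M)
    (hM : ∀ i ∈ T, |P.eval (i : ℝ)| ≤ M) (n : ℕ) (hn : n ≤ N) :
    |P.eval (n : ℝ)| ≤ 16 ^ N * M := by
  have hinj : Set.InjOn (fun i : ℕ => (i : ℝ)) T := Nat.cast_injective.injOn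
  rw [Lagrange.eq_interpolate hinj hdeg, Lagrange.interpolate_apply, Polynomial.eval_finsetSum]
  have hterm : ∀ i ∈ T, |Polynomial.eval (n : ℝ) (Polynomial.C (P.eval (i : ℝ)) *
      Lagrange.basis T (fun i : ℕ => (i : ℝ)) i)| ≤ M * 8 ^ N := by
    intro i hi
    rw [Polynomial.eval_mul, Polynomial.eval_C, abs_mul]
    refine mul_le_mul (hM i hi) ?_ (abs_nonneg _) hM0
    have hprod : Polynomial.eval (n : ℝ) (Lagrange.basis T (fun i : ℕ => (i : ℝ)) i) =
        (∏ l ∈ T.erase i, ((n : ℝ) - l)) / ∏ l ∈ T.erase i, ((i : ℝ) - l) := by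
      rw [Lagrange.basis, Polynomial.eval_prod, ← prod_div_distrib]
      refine prod_congr rfl fun l _ => ?_
      simp [Lagrange.basisDivisor, div_eq_inv_mul]
    rw [hprod, abs_div, abs_prod, abs_prod]
    have hnum : ∏ l ∈ T.erase i, |(n : ℝ) - l| ≤ (N : ℝ) ^ #(T.erase i) := by
      rw [← prod_const]
      refine prod_le_prod (fun _ _ => abs_nonneg _) fun l hl => ?_
      have hl := mem_range.1 (hT (mem_of_mem_erase hl))
      have h1 : (l : ℝ) ≤ N := by exact_mod_cast Nat.lt_succ_iff.1 hl
      have h2 : (n : ℝ) ≤ N := by exact_mod_cast hn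
      rw [abs_le]
      constructor <;> linarith [Nat.cast_nonneg (α := ℝ) n, Nat.cast_nonneg (α := ℝ) l]
    have hden := factorial_le_two_pow_mul_prod_sub (T.erase i) i (notMem_erase i T)
    refine le_trans ?_ (two_mul_pow_div_factorial_le N #(T.erase i))
    have hf : (0 : ℝ) < ((#(T.erase i)).factorial : ℝ) := by positivity
    have hd : 0 < ∏ l ∈ T.erase i, |(i : ℝ) - l| := by
      by_contra hneg
      have : (2 : ℝ) ^ #(T.erase i) * ∏ l ∈ T.erase i, |(i : ℝ) - l| ≤ 0 :=
        mul_nonpos_of_nonneg_of_nonpos (by positivity) (not_lt.1 hneg)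
      linarith
    rw [div_le_div_iff₀ hd hf, mul_pow]
    calc _ ≤ (N : ℝ) ^ #(T.erase i) * (2 ^ #(T.erase i) * ∏ l ∈ T.erase i, |(i : ℝ) - l|) := by
          gcongr
      _ = _ := by ring
  calc _ ≤ ∑ i ∈ T, M * 8 ^ N := (abs_sum_le_sum_abs _ _).trans (sum_le_sum hterm)
    _ = #T * (M * 8 ^ N) := by simp
    _ ≤ 2 ^ N * (M * 8 ^ N) := by
        gcongr
        have h1 : #T ≤ N + 1 := by simpa using card_le_card hT
        have h2 : N + 1 ≤ 2 ^ N := Nat.lt_two_pow_self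
        exact_mod_cast h1.trans h2
    _ = 16 ^ N * M := by
        rw [show (16 : ℝ) = 2 * 8 by norm_num, mul_pow]; ring

theorem abs_fwdDiff_iter_le (g : ℕ → ℝ) (c : ℝ) (k n : ℕ) (h : ∀ i ≤ k, |g (n + i)| ≤ c) :
    |(fwdDiff 1)^[k] g n| ≤ 2 ^ k * c := by
  induction k generalizing n with
  | zero => simpa using h 0 le_rfl
  | succ k ih =>
    rw [Function.iterate_succ_apply', fwdDiff]
    have h1 := ih n fun i hi => h i (by omega)
    have h2 := ih (n + 1) fun i hi => by
      rw [add_assoc, add_comm 1 i]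
      exact h (i + 1) (by omega)
    calc _ ≤ _ := abs_sub _ _
      _ ≤ 2 ^ k * c + 2 ^ k * c := add_le_add h2 h1
      _ = _ := by ring

/-- A discrete Remez inequality for functions whose `j`-th difference is small. -/
theorem abs_le_of_abs_fwdDiff_iter_le (w : ℕ → ℝ) (N j : ℕ) (hN : 1 ≤ N) (B : ℝ) (hB : 0 ≤ B)
    (hdiff : ∀ n, n + j ≤ N → |(fwdDiff 1)^[j] w n| ≤ B)
    (T : Finset ℕ) (hT : T ⊆ range (N + 1)) (hj : j ≤ #T) (hw : ∀ n ∈ T, |w n| ≤ B)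
    (n : ℕ) (hn : n ≤ N) : |w n| ≤ 144 ^ N * B := by
  set c : ℕ → ℝ := fun k => (fwdDiff 1)^[k] w 0 with hc
  set P : Polynomial ℝ :=
    ∑ k ∈ range j, Polynomial.C (c k / (k.factorial : ℝ)) * descPochhammer ℝ k with hP
  have hPeval : ∀ m : ℕ, P.eval (m : ℝ) = ∑ k ∈ range j, (m.choose k : ℝ) * c k := by
    intro m
    rw [hP, Polynomial.eval_finsetSum]
    refine sum_congr rfl fun k _ => ?_
    rw [Polynomial.eval_mul, Polynomial.eval_C, Nat.cast_choose_eq_descPochhammer_div]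
    ring
  have hjN : j ≤ N + 1 := hj.trans (by simpa using card_le_card hT)
  have hnewton : ∀ m ≤ N, w m = ∑ k ∈ range (N + 1), (m.choose k : ℝ) * c k := by
    intro m hm
    have h := shift_eq_sum_fwdDiff_iter (1 : ℕ) w m 0
    simp only [smul_eq_mul, mul_one, zero_add, nsmul_eq_mul] at h
    rw [h]
    refine sum_subset (range_subset_range.2 (by omega)) fun k _ hk => ?_
    rw [mem_range, not_lt] at hk
    rw [Nat.choose_eq_zero_of_lt (by omega)]
    simp
  have hcoef : ∀ k, j ≤ k → k ≤ N → |c k| ≤ 2 ^ k * B := by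
    intro k hjk hkN
    have h := abs_fwdDiff_iter_le ((fwdDiff 1)^[j] w) B (k - j) 0 fun i hi => by
      rw [zero_add]
      exact hdiff i (by omega)
    rw [← Function.iterate_add_apply, Nat.sub_add_cancel hjk] at h
    refine h.trans ?_
    gcongr
    · norm_num
    · omega
  have hrem : ∀ m ≤ N, |w m - P.eval (m : ℝ)| ≤ 3 ^ N * B := by
    intro m hm
    rw [hnewton m hm, hPeval, ← sum_range_add_sum_Ico _ hjN, add_sub_cancel_left]
    calc _ ≤ ∑ k ∈ Ico j (N + 1), (N.choose k : ℝ) * (2 ^ k * B) := by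
          refine (abs_sum_le_sum_abs _ _).trans (sum_le_sum fun k hk => ?_)
          rw [mem_Ico] at hk
          rw [abs_mul, Nat.abs_cast]
          have h1 : (m.choose k : ℝ) ≤ N.choose k := by exact_mod_cast Nat.choose_le_choose k hm
          have h2 := hcoef k hk.1 (by omega)
          gcongr
      _ ≤ ∑ k ∈ range (N + 1), (N.choose k : ℝ) * (2 ^ k * B) := by
          refine sum_le_sum_of_subset_of_nonneg ?_ fun _ _ _ => by positivity
          intro k hk
          rw [mem_Ico] at hk
          exact mem_range.2 hk.2
      _ = (2 + 1) ^ N * B := by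
          rw [add_pow, sum_mul]
          refine sum_congr rfl fun k _ => ?_
          rw [one_pow]
          ring
      _ = _ := by norm_num
  have hdeg : P.degree < #T := by
    refine lt_of_lt_of_le ?_ (Nat.cast_le.2 hj)
    refine (Polynomial.degree_sum_le _ _).trans_lt ?_
    rw [Finset.sup_lt_iff (by exact WithBot.bot_lt_coe _)]
    intro k hk
    rw [← Polynomial.smul_eq_C_mul]
    refine (Polynomial.degree_smul_le _ _).trans_lt ?_
    refine Polynomial.degree_le_natDegree.trans_lt ?_
    rw [descPochhammer_natDegree]
    exact_mod_cast mem_range.1 hk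
  have h3 : (1 : ℝ) ≤ 3 ^ N := one_le_pow₀ (by norm_num)
  have hPn := abs_eval_le_of_abs_eval_le P N T hT hdeg (2 * 3 ^ N * B) (by positivity) (by
    intro i hi
    have h1 := hrem i (Nat.lt_succ_iff.1 (mem_range.1 (hT hi)))
    have h2 := hw i hi
    have h4 := abs_sub_abs_le_abs_sub (P.eval (i : ℝ)) (w i)
    rw [abs_sub_comm] at h4
    nlinarith) n hn
  have h4 := hrem n hn
  have h5 := abs_sub_abs_le_abs_sub (w n) (P.eval (n : ℝ))
  have h6 : (3 : ℝ) ^ N * B ≤ 48 ^ N * B := by gcongr; norm_num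
  have h7 : (3 : ℝ) * 48 ^ N ≤ 144 ^ N := by
    rw [show (144 : ℝ) = 3 * 48 by norm_num, mul_pow]
    gcongr
    exact le_self_pow₀ (by norm_num) (by omega)
  have h8 : (16 : ℝ) ^ N * (2 * 3 ^ N * B) = 2 * (48 ^ N * B) := by
    rw [show (48 : ℝ) = 16 * 3 by norm_num, mul_pow]
    ring
  nlinarith

/-- If consecutive lines satisfy the triangle relation up to `1`, the values on the last line
control those on the previous ones. -/
theorem abs_le_of_triangle_relation (f : ℕ → ℕ → ℝ) (j N : ℕ) (A : ℝ)
    (hrel : ∀ i n, i < j → n + j ≤ N + i → |f (i + 1) n + f (i + 1) (n + 1) + f i n| ≤ 1)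
    (hA : ∀ n ≤ N, |f j n| ≤ A) (i k : ℕ) (hik : i + k = j) (n : ℕ) (hn : n + i ≤ N) :
    |f k n| ≤ 2 ^ i * (A + 1) - 1 := by
  induction i generalizing k n with
  | zero =>
    obtain rfl : k = j := by omega
    simpa using hA n (by omega)
  | succ i ih =>
    have h1 := ih (k + 1) (by omega) n (by omega)
    have h2 := ih (k + 1) (by omega) (n + 1) (by omega)
    have h3 := hrel k n (by omega) (by omega)
    rw [abs_le] at *
    rw [pow_succ]
    constructor <;> linarith

theorem abs_fwdDiff_iter_sub_le (w : ℕ → ℕ → ℝ) (j N : ℕ)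
    (hw : ∀ i n, i < j → n + j ≤ N + i → |fwdDiff 1 (w (i + 1)) n - w i n| ≤ 1)
    (n : ℕ) (hn : n + j ≤ N) : |(fwdDiff 1)^[j] (w j) n - w 0 n| ≤ 2 ^ j - 1 := by
  induction j generalizing N with
  | zero => simp
  | succ j ih =>
    have h1 := ih (N - 1) (fun i n hi hn => hw i n (by omega) (by omega)) (by omega)
    have h2 := abs_fwdDiff_iter_le (fun n => fwdDiff 1 (w (j + 1)) n + (-1 : ℝ) • w j n) 1 j n
      fun i hi => by
        have := hw j (n + i) (by omega) (by omega)
        simpa [sub_eq_add_neg] using this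
    have h3 := congrFun (fwdDiff_iter_add 1 (fwdDiff 1 (w (j + 1))) ((-1 : ℝ) • w j) j) n
    rw [fwdDiff_iter_const_smul] at h3
    simp only [Pi.add_apply, Pi.smul_apply] at h3
    change |(fwdDiff 1)^[j] (fwdDiff 1 (w (j + 1)) + (-1 : ℝ) • w j) n| ≤ _ at h2
    rw [h3, smul_eq_mul] at h2
    rw [Function.iterate_succ_apply]
    rw [abs_le] at *
    rw [pow_succ]
    constructor <;> linarith

/-- Under the triangle relation, a bound on a line extends to the `j`-th next line, on an interval
which is longer by `j`, as soon as that interval has `j` points with values at most `1`. -/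
theorem abs_le_of_many_small (f : ℕ → ℕ → ℝ) (j N : ℕ) (hj : 1 ≤ j) (hjN : j ≤ N) (A : ℝ)
    (hA : 1 ≤ A)
    (hrel : ∀ i n, i < j → n + j ≤ N + i → |f (i + 1) n + f (i + 1) (n + 1) + f i n| ≤ 1)
    (h0 : ∀ n, n + j ≤ N → |f 0 n| ≤ A)
    (T : Finset ℕ) (hT : T ⊆ range (N + 1)) (hjT : j ≤ #T) (hf : ∀ n ∈ T, |f j n| ≤ 1)
    (n : ℕ) (hn : n ≤ N) : |f j n| ≤ 576 ^ N * A := by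
  set w : ℕ → ℕ → ℝ := fun i n => (-1) ^ n * f i n with hw
  have hwabs : ∀ i n, |w i n| = |f i n| := fun i n => by simp [hw, abs_mul]
  have hdiff := abs_fwdDiff_iter_sub_le w j N (by
    intro i n hi hn
    rw [fwdDiff]
    have h : w (i + 1) (n + 1) - w (i + 1) n - w i n =
        -(-1) ^ n * (f (i + 1) n + f (i + 1) (n + 1) + f i n) := by
      simp only [hw]
      ring
    rw [h, abs_mul]
    simpa using hrel i n hi hn)
  have h2 : (1 : ℝ) ≤ 2 ^ j := one_le_pow₀ (by norm_num)
  have hmain := abs_le_of_abs_fwdDiff_iter_le (w j) N j (by omega) (2 ^ j * A) (by positivity) (by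
    intro n hn
    have h1 := hdiff n hn
    have h3 := h0 n hn
    rw [← hwabs] at h3
    have h4 := abs_sub_abs_le_abs_sub ((fwdDiff 1)^[j] (w j) n) (w 0 n)
    nlinarith) T hT hjT (by
    intro n hn
    rw [hwabs]
    have := hf n hn
    nlinarith) n hn
  rw [hwabs] at hmain
  refine hmain.trans ?_
  rw [← mul_assoc, show (576 : ℝ) = 144 * 4 by norm_num, mul_pow]
  have : (2 : ℝ) ^ j ≤ 4 ^ N := calc
    (2 : ℝ) ^ j ≤ 4 ^ j := by gcongr; norm_num
    _ ≤ 4 ^ N := by gcongr; norm_num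
  gcongr

theorem card_mul_le_card_of_le_card_fiber {α β : Type*} [DecidableEq β] (S : Finset α) (g : α → β)
    (T : Finset β) (c : ℕ) (h : ∀ b ∈ T, c ≤ #(S.filter (g · = b))) : #T * c ≤ #S := by
  have h1 : #(S.filter (g · ∈ T)) = ∑ b ∈ T, #((S.filter (g · ∈ T)).filter (g · = b)) :=
    card_eq_sum_card_fiberwise fun x hx => (mem_filter.1 hx).2
  have h2 : ∑ _b ∈ T, c ≤ ∑ b ∈ T, #((S.filter (g · ∈ T)).filter (g · = b)) := by
    refine sum_le_sum fun b hb => (h b hb).trans (card_le_card fun x hx => ?_)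
    simp only [mem_filter] at hx ⊢
    exact ⟨⟨hx.1, hx.2 ▸ hb⟩, hx.2⟩
  rw [sum_const, smul_eq_mul, ← h1] at h2
  exact h2.trans (card_filter_le _ _)

/-- The square `[x₁, x₁ + r) × [x₂, x₂ + r)`. -/
def cornerSquare (x : ℕ × ℕ) (r : ℕ) : Finset (ℕ × ℕ) :=
  Ico x.1 (x.1 + r) ×ˢ Ico x.2 (x.2 + r)

/-- A Vitali covering argument: if every point of `X` is the corner of a square in which `S` has
density at least `1 / 9`, then `X` is not much larger than `S`. -/
theorem card_le_of_dense_cornerSquare (r : ℕ × ℕ → ℕ) (X S : Finset (ℕ × ℕ))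
    (h : ∀ x ∈ X, 0 < r x ∧ r x ^ 2 ≤ 9 * #(S ∩ cornerSquare x (r x))) : #X ≤ 36 * #S := by
  induction X using Finset.strongInduction generalizing S with
  | H X ih =>
  rcases X.eq_empty_or_nonempty with rfl | hne
  · simp
  obtain ⟨x, hx, hmax⟩ := exists_max_image X r hne
  set Q := cornerSquare x (r x) with hQ
  set X' := X.filter fun y => Disjoint Q (cornerSquare y (r y)) with hX'
  have hrx := (h x hx).1
  have hxX' : x ∉ X' := by
    intro hmem
    have hd := (mem_filter.1 hmem).2
    have hxQ : x ∈ Q := by simp [hQ, cornerSquare, hrx]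
    exact disjoint_left.1 hd hxQ hxQ
  have hlt : X' ⊂ X := (filter_subset _ _).ssubset_of_mem_notMem hx hxX'
  have hIH := ih X' hlt (S \ Q) fun y hy => by
    obtain ⟨hyX, hd⟩ := mem_filter.1 hy
    have heq : (S \ Q) ∩ cornerSquare y (r y) = S ∩ cornerSquare y (r y) := by
      ext z
      simp only [mem_inter, mem_sdiff]
      have := fun hz : z ∈ Q => disjoint_left.1 hd hz
      tauto
    rw [heq]
    exact h y hyX
  have hrest : #(X \ X') ≤ 4 * r x ^ 2 := by
    have hsub : X \ X' ⊆ Ico (x.1 - r x) (x.1 + r x) ×ˢ Ico (x.2 - r x) (x.2 + r x) := by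
      intro y hy
      simp only [hX', mem_sdiff, mem_filter, not_and] at hy
      have hm := hmax y hy.1
      obtain ⟨z, hz1, hz2⟩ := not_disjoint_iff.1 (hy.2 hy.1)
      simp only [hQ, cornerSquare, mem_product, mem_Ico] at hz1 hz2 ⊢
      omega
    refine (card_le_card hsub).trans ?_
    rw [card_product, Nat.card_Ico, Nat.card_Ico]
    calc _ ≤ (2 * r x) * (2 * r x) := Nat.mul_le_mul (by omega) (by omega)
      _ = _ := by ring
  have h1 := card_sdiff_add_card_eq_card hlt.subset
  have h2 := card_sdiff_add_card_inter S Q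
  have h3 := (h x hx).2
  rw [← hQ] at h3
  omega

theorem le_card_large_of_card_small_lt (N j : ℕ) (g : ℕ → ℝ)
    (h : #((range (N + 1)).filter (|g ·| < 1)) < j) :
    N + 2 ≤ j + #((range (N + 1)).filter (1 ≤ |g ·|)) := by
  have h1 := card_filter_add_card_filter_not (s := range (N + 1)) (p := (|g ·| < 1))
  simp only [not_lt, card_range] at h1
  omega

/-- Either the cone with apex `(s, t)` can be enlarged while remaining under control, or there are
many large values below it. -/
theorem exists_larger_tame_or_many_large (m : ℕ) (v : ℕ → ℕ → ℝ)
    (hrel : ∀ s t, s + 1 ≤ t → t + 1 ≤ m → |v (s + 1) t + v (s + 1) (t + 1) + v s t| ≤ 1)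
    (S : Finset (ℕ × ℕ)) (hS : ∀ s t, s ≤ t → t ≤ m → 1 ≤ |v s t| → (s, t) ∈ S)
    (s t n : ℕ) (hst : s + (3 * n + 2) ≤ t) (htm : t + (3 * n + 2) ≤ m)
    (htame : ∀ i ≤ n, |v (s + n) (t + i)| ≤ 331776 ^ n) :
    (∃ k, n < k ∧ k ≤ 3 * n + 2 ∧ ∀ i ≤ k, |v (s + k) (t + i)| ≤ 331776 ^ k) ∨
      (3 * n + 3) ^ 2 ≤ 9 * #(S ∩ cornerSquare (s, t) (3 * n + 3)) := by
  by_cases hmany : ∃ j ∈ Icc (n + 1) (2 * n + 2),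
      j ≤ #((range (n + j + 1)).filter fun k => |v (s + n + j) (t + k)| < 1)
  · left
    obtain ⟨j, hj, hcard⟩ := hmany
    rw [mem_Icc] at hj
    refine ⟨n + j, by omega, by omega, fun i hi => ?_⟩
    have := abs_le_of_many_small (fun i k => v (s + n + i) (t + k)) j (n + j) (by omega) (by omega)
      (331776 ^ n) (one_le_pow₀ (by norm_num))
      (fun i k hi hk => hrel (s + n + i) (t + k) (by omega) (by omega))
      (fun k hk => htame k (by omega)) _ (filter_subset _ _) hcard
      (fun k hk => (mem_filter.1 hk).2.le) i hi
    simp only [← add_assoc] at this ⊢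
    refine this.trans ?_
    rw [pow_add (331776 : ℝ), mul_comm]
    refine mul_le_mul_of_nonneg_left ?_ (by positivity)
    rw [show (331776 : ℝ) = 576 ^ 2 by norm_num, ← pow_mul]
    exact pow_le_pow_right₀ (by norm_num) (by omega)
  · right
    push Not at hmany
    have := card_mul_le_card_of_le_card_fiber (S ∩ cornerSquare (s, t) (3 * n + 3)) Prod.fst
      ((Icc (n + 1) (2 * n + 2)).image (s + n + ·)) (n + 2) (by
        intro b hb
        obtain ⟨j, hj, rfl⟩ := mem_image.1 hb
        have h1 := le_card_large_of_card_small_lt _ _ (fun k => v (s + n + j) (t + k)) (hmany j hj)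
        have h2 : #((range (n + j + 1)).filter fun k => 1 ≤ |v (s + n + j) (t + k)|) ≤
            #((S ∩ cornerSquare (s, t) (3 * n + 3)).filter (Prod.fst · = s + n + j)) := by
          refine card_le_card_of_injOn (fun k => (s + n + j, t + k)) ?_ ?_
          · intro k hk
            rw [mem_Icc] at hj
            simp only [coe_filter, mem_range, Set.mem_ofPred_eq, mem_inter, cornerSquare,
              mem_product, mem_Ico] at hk ⊢
            exact ⟨⟨hS _ _ (by omega) (by omega) hk.2, by omega⟩, trivial⟩
          · intro k _ k' _ hkk
            simpa using hkk
        omega)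
    rw [card_image_of_injective _ (add_right_injective _), Nat.card_Icc] at this
    have h3 : 2 * n + 2 + 1 - (n + 1) = n + 2 := by omega
    rw [h3] at this
    nlinarith

/-- If the base of a large cone whose apex is close to the point `(0, 16 * ρ)` is under control but
the value at that point is huge, then there are many large values to the right of the cone. -/
theorem sq_le_card_large_of_tame_cone (ρ : ℕ) (v : ℕ → ℕ → ℝ)
    (hrel : ∀ s t, s + 1 ≤ t → t + 1 ≤ 32 * ρ →
      |v (s + 1) t + v (s + 1) (t + 1) + v s t| ≤ 1)
    (S : Finset (ℕ × ℕ)) (hS : ∀ s t, s ≤ t → t ≤ 32 * ρ → 1 ≤ |v s t| → (s, t) ∈ S)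
    (hc : 331776 ^ (64 * ρ) ≤ |v 0 (16 * ρ)|)
    (s t n : ℕ) (hs : s < ρ) (ht : 15 * ρ < t) (ht' : t ≤ 16 * ρ)
    (hn : 4 * ρ ≤ n) (hn' : n ≤ 12 * ρ)
    (htame : ∀ i ≤ n, |v (s + n) (t + i)| ≤ 331776 ^ n) : ρ ^ 2 ≤ #S := by
  obtain ⟨U, rfl⟩ : ∃ U, t = U + s := ⟨t - s, by omega⟩
  set N := s + n with hN
  set f : ℕ → ℕ → ℝ := fun i k => v (N - k) (U + i + (N - k)) with hf
  have hfrel : ∀ j ≤ 3 * ρ, ∀ i k, i < j → k + j ≤ N + i →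
      |f (i + 1) k + f (i + 1) (k + 1) + f i k| ≤ 1 := by
    intro j hj i k hi hk
    obtain ⟨q, hq⟩ : ∃ q, N - k = q + 1 := ⟨N - k - 1, by omega⟩
    have h := hrel q (U + i + (q + 1)) (by omega) (by omega)
    simp only [hf, hq, show N - (k + 1) = q by omega,
      show U + (i + 1) + (q + 1) = U + i + (q + 1) + 1 by omega,
      show U + (i + 1) + q = U + i + (q + 1) by omega]
    convert h using 2
    ring
  by_cases hmany : ∃ j ∈ Icc (2 * ρ) (3 * ρ), j ≤ #((range (N + 1)).filter fun k => |f j k| < 1)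
  · exfalso
    obtain ⟨j, hj, hcard⟩ := hmany
    rw [mem_Icc] at hj
    have hCn : (1 : ℝ) ≤ 331776 ^ n := one_le_pow₀ (by norm_num)
    have hside : ∀ k, k + j ≤ N → |f 0 k| ≤ 2 ^ (n + 1) * 331776 ^ n := by
      intro k hk
      have h := abs_le_of_triangle_relation (fun i k => v (s + i) (U + s + k)) n n (331776 ^ n)
        (fun i k hi hk => hrel (s + i) (U + s + k) (by omega) (by omega)) htame
        k (n - k) (by omega) (n - k) (by omega)
      simp only [hf]
      rw [show N - k = s + (n - k) by omega, add_zero, ← add_assoc]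
      refine h.trans ?_
      have h2 : (2 : ℝ) ^ k ≤ 2 ^ n := pow_le_pow_right₀ (by norm_num) (by omega)
      have h3 : (2 : ℝ) ^ k * (331776 ^ n + 1) ≤ 2 ^ n * (331776 ^ n + 331776 ^ n) := by gcongr
      rw [pow_succ]
      linarith
    set A : ℝ := 576 ^ N * (2 ^ (n + 1) * 331776 ^ n) with hA
    have hCA : (331776 : ℝ) ^ n ≤ A := by
      have h1 : (1 : ℝ) ≤ 576 ^ N := one_le_pow₀ (by norm_num)
      have h2 : (1 : ℝ) ≤ 2 ^ (n + 1) := one_le_pow₀ (by norm_num)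
      rw [hA, ← mul_assoc]
      exact le_mul_of_one_le_left (by positivity) (one_le_mul_of_one_le_of_one_le h1 h2)
    have hA1 : 1 ≤ A := hCn.trans hCA
    have hline : ∀ k ≤ N, |f j k| ≤ A :=
      abs_le_of_many_small f j N (by omega) (by omega) _
        (one_le_mul_of_one_le_of_one_le (one_le_pow₀ (by norm_num)) hCn) (hfrel j hj.2) hside
        _ (filter_subset _ _) hcard (fun k hk => (mem_filter.1 hk).2.le)
    have h2j : (1 : ℝ) ≤ 2 ^ j := one_le_pow₀ (by norm_num)
    have hbase : ∀ k ≤ n + j, |v N (U + s + k)| ≤ 2 ^ (j + 1) * A := by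
      intro k hk
      rcases le_or_gt k n with hkn | hkn
      · refine (htame k hkn).trans (hCA.trans ?_)
        exact le_mul_of_one_le_left (by linarith) (one_le_pow₀ (by norm_num))
      · obtain ⟨i, rfl⟩ : ∃ i, k = n + i := ⟨k - n, by omega⟩
        have h := abs_le_of_triangle_relation f j N A (hfrel j hj.2) hline (j - i) i (by omega)
          0 (by omega)
        simp only [hf] at h
        rw [show U + s + (n + i) = U + i + (N - 0) by omega]
        refine h.trans ?_
        have h2 : (2 : ℝ) ^ (j - i) ≤ 2 ^ j := pow_le_pow_right₀ (by norm_num) (by omega)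
        rw [pow_succ]
        nlinarith
    have hcen := abs_le_of_triangle_relation (fun i k => v i (16 * ρ + k)) N N (2 ^ (j + 1) * A)
      (fun i k hi hk => hrel i (16 * ρ + k) (by omega) (by omega)) (fun k hk => by
        have := hbase (16 * ρ + k - (U + s)) (by omega)
        rwa [show U + s + (16 * ρ + k - (U + s)) = 16 * ρ + k by omega] at this)
      N 0 (by omega) 0 (by omega)
    have h1 : |v 0 (16 * ρ)| < 2 ^ (N + j + 2 + (n + 1)) * 576 ^ N * 331776 ^ n := by
      have h3 : (1 : ℝ) ≤ 2 ^ N := one_le_pow₀ (by norm_num)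
      have h4 : (1 : ℝ) ≤ 2 ^ (j + 1) * A :=
        one_le_mul_of_one_le_of_one_le (one_le_pow₀ (by norm_num)) hA1
      calc |v 0 (16 * ρ)| ≤ 2 ^ N * (2 ^ (j + 1) * A + 1) - 1 := hcen
        _ < 2 ^ N * (2 ^ (j + 1) * A + 2 ^ (j + 1) * A) := by nlinarith
        _ = _ := by rw [hA]; ring
    have h2 : (2 : ℝ) ^ (N + j + 2 + (n + 1)) ≤ 331776 ^ (31 * ρ) :=
      calc (2 : ℝ) ^ (N + j + 2 + (n + 1)) ≤ 331776 ^ (N + j + 2 + (n + 1)) := by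
            gcongr; norm_num
        _ ≤ _ := pow_le_pow_right₀ (by norm_num) (by omega)
    have h3 : (576 : ℝ) ^ N ≤ 331776 ^ (13 * ρ) :=
      calc (576 : ℝ) ^ N ≤ 331776 ^ N := by gcongr; norm_num
        _ ≤ _ := pow_le_pow_right₀ (by norm_num) (by omega)
    have h4 : (331776 : ℝ) ^ n ≤ 331776 ^ (12 * ρ) := pow_le_pow_right₀ (by norm_num) hn'
    have h5 : (331776 : ℝ) ^ (31 * ρ) * 331776 ^ (13 * ρ) * 331776 ^ (12 * ρ) ≤
        331776 ^ (64 * ρ) := by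
      rw [← pow_add, ← pow_add]
      exact pow_le_pow_right₀ (by norm_num) (by omega)
    have h6 : (2 : ℝ) ^ (N + j + 2 + (n + 1)) * 576 ^ N * 331776 ^ n ≤
        331776 ^ (31 * ρ) * 331776 ^ (13 * ρ) * 331776 ^ (12 * ρ) := by gcongr
    linarith
  · push Not at hmany
    have := card_mul_le_card_of_le_card_fiber S (fun p => p.2 - p.1)
      ((Icc (2 * ρ) (3 * ρ)).image (U + ·)) ρ (by
        intro b hb
        obtain ⟨j, hj, rfl⟩ := mem_image.1 hb
        have h1 := le_card_large_of_card_small_lt _ _ (f j) (hmany j hj)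
        rw [mem_Icc] at hj
        have h2 : #((range (N + 1)).filter fun k => 1 ≤ |f j k|) ≤
            #(S.filter fun p => p.2 - p.1 = U + j) := by
          refine card_le_card_of_injOn (fun k => (N - k, U + j + (N - k))) ?_ ?_
          · intro k hk
            simp only [coe_filter, mem_range, Set.mem_ofPred_eq] at hk ⊢
            exact ⟨hS _ _ (by omega) (by omega) hk.2, by omega⟩
          · intro k hk k' hk' hkk
            simp only [coe_filter, mem_range, Set.mem_ofPred_eq, Prod.mk.injEq] at hk hk' hkk
            omega
        omega)
    rw [card_image_of_injective _ (add_right_injective _), Nat.card_Icc] at this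
    have h3 : 3 * ρ + 1 - 2 * ρ = ρ + 1 := by omega
    rw [h3] at this
    nlinarith

theorem sq_le_card_large_of_huge_center (ρ : ℕ) (v : ℕ → ℕ → ℝ)
    (hrel : ∀ s t, s + 1 ≤ t → t + 1 ≤ 32 * ρ →
      |v (s + 1) t + v (s + 1) (t + 1) + v s t| ≤ 1)
    (S : Finset (ℕ × ℕ)) (hS : ∀ s t, s ≤ t → t ≤ 32 * ρ → 1 ≤ |v s t| → (s, t) ∈ S)
    (hc : 331776 ^ (64 * ρ) ≤ |v 0 (16 * ρ)|) : ρ ^ 2 ≤ 37 * #S := by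
  set R : Finset (ℕ × ℕ) := range ρ ×ˢ Ioc (15 * ρ) (16 * ρ) with hR
  have hRcard : #R = ρ ^ 2 := by
    rw [hR, card_product, card_range, Nat.card_Ioc, show 16 * ρ - 15 * ρ = ρ by omega, sq]
  set X := R.filter fun x => |v x.1 x.2| < 1 with hX
  have hXS : #R ≤ #X + #S := by
    have h1 := card_filter_add_card_filter_not (s := R) (p := fun x => |v x.1 x.2| < 1)
    have h2 : #(R.filter fun x => ¬ |v x.1 x.2| < 1) ≤ #S := by
      refine card_le_card fun x hx => ?_
      simp only [hR, mem_filter, mem_product, mem_range, mem_Ioc, not_lt] at hx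
      exact hS x.1 x.2 (by omega) (by omega) hx.2
    rw [← hX] at h1
    omega
  by_cases hcone : ∃ x ∈ R, ∃ n, 4 * ρ ≤ n ∧ n ≤ 12 * ρ ∧
      ∀ i ≤ n, |v (x.1 + n) (x.2 + i)| ≤ 331776 ^ n
  · obtain ⟨x, hx, n, hn, hn', htame⟩ := hcone
    simp only [hR, mem_product, mem_range, mem_Ioc] at hx
    have := sq_le_card_large_of_tame_cone ρ v hrel S hS hc x.1 x.2 n hx.1 hx.2.1 hx.2.2 hn hn' htame
    omega
  · push Not at hcone
    have hdense : ∀ x ∈ X, ∃ r, 0 < r ∧ r ^ 2 ≤ 9 * #(S ∩ cornerSquare x r) := by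
      intro x hx
      obtain ⟨hxR, hxsmall⟩ := mem_filter.1 hx
      set E := (range (12 * ρ + 1)).filter fun n =>
        ∀ i ≤ n, |v (x.1 + n) (x.2 + i)| ≤ 331776 ^ n with hE
      have h0 : 0 ∈ E := by simpa [hE] using hxsmall.le
      obtain ⟨n, hnE, hmax⟩ := exists_max_image E id ⟨0, h0⟩
      simp only [hE, mem_filter, mem_range, id] at hnE hmax
      have hn4 : n < 4 * ρ := by
        by_contra hge
        obtain ⟨i, hi, hlt⟩ := hcone x hxR n (by omega) (by omega)
        exact absurd (hnE.2 i hi) (not_le.2 hlt)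
      have hxR' := hxR
      simp only [hR, mem_product, mem_range, mem_Ioc] at hxR'
      rcases exists_larger_tame_or_many_large (32 * ρ) v hrel S hS x.1 x.2 n (by omega) (by omega)
        hnE.2 with ⟨k, hnk, hk, htame⟩ | h
      · have := hmax k ⟨by omega, htame⟩
        omega
      · exact ⟨3 * n + 3, by omega, h⟩
    choose! r hr using hdense
    have := card_le_of_dense_cornerSquare r X S hr
    omega

theorem sq_le_card_large (m l : ℕ) (δ : ℝ) (hδ : 0 ≤ δ) (v : ℕ → ℕ → ℝ)
    (hrel : ∀ s t, s + 1 ≤ l → s + 1 ≤ t → t + 1 ≤ m →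
      |v (s + 1) t + v (s + 1) (t + 1) + v s t| ≤ δ)
    (c : ℕ) (hc : l / 2 ≤ c) (hcm : c + l / 2 ≤ m)
    (S : Finset (ℕ × ℕ))
    (hS : ∀ s t, s ≤ l → s ≤ t → c ≤ t + l / 2 → t ≤ c + l / 2 → δ ≤ |v s t| → (s, t) ∈ S)
    (hbig : 331776 ^ (2 * l) * δ ≤ |v 0 c|) : (l + 1) ^ 2 ≤ 151552 * #S := by
  set ρ := l / 32 with hρ
  rcases Nat.eq_zero_or_pos ρ with h0 | hpos
  · have hmem : (0, c) ∈ S := by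
      refine hS 0 c (by omega) (by omega) (by omega) (by omega) (le_trans ?_ hbig)
      exact le_mul_of_one_le_left hδ (one_le_pow₀ (by norm_num))
    have : 0 < #S := card_pos.2 ⟨_, hmem⟩
    have hl : l + 1 ≤ 32 := by omega
    nlinarith
  suffices h : ρ ^ 2 ≤ 37 * #S by
    have hl : l + 1 ≤ 64 * ρ := by omega
    have := Nat.pow_le_pow_left hl 2
    rw [mul_pow] at this
    omega
  obtain ⟨p, rfl⟩ : ∃ p, c = p + 16 * ρ := ⟨c - 16 * ρ, by omega⟩
  rcases hδ.eq_or_lt with rfl | hδ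
  · have hsub : range ρ ×ˢ Ico (p + ρ) (p + 2 * ρ) ⊆ S := by
      rintro ⟨s, t⟩ hst
      simp only [mem_product, mem_range, mem_Ico] at hst
      exact hS s t (by omega) (by omega) (by omega) (by omega) (abs_nonneg _)
    have := card_le_card hsub
    rw [card_product, card_range, Nat.card_Ico, show p + 2 * ρ - (p + ρ) = ρ by omega, ← sq] at this
    omega
  · have h := sq_le_card_large_of_huge_center ρ (fun s t => v s (p + t) / δ) (by
      intro s t hs ht
      rw [← add_div, ← add_div, abs_div, abs_of_pos hδ, div_le_one hδ]
      exact hrel s (p + t) (by omega) (by omega) (by omega))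
      ((S.filter (p ≤ ·.2)).image fun x => (x.1, x.2 - p)) (by
        intro s t hst ht h
        rw [abs_div, abs_of_pos hδ, one_le_div hδ] at h
        refine mem_image.2 ⟨(s, p + t), mem_filter.2 ⟨?_, by simp⟩, by simp⟩
        exact hS _ _ (by omega) (by omega) (by omega) (by omega) h) (by
        rw [abs_div, abs_of_pos hδ, le_div_iff₀ hδ]
        refine le_trans ?_ hbig
        exact mul_le_mul_of_nonneg_right (pow_le_pow_right₀ (by norm_num) (by omega)) hδ.le)
    have h2 := (card_image_le (s := S.filter (p ≤ ·.2)) (f := fun x => (x.1, x.2 - p))).trans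
      (card_filter_le _ _)
    omega

theorem mul_le_card_large (m l : ℕ) (hlm : l ≤ m) (hm : 2 ≤ m) (δ : ℝ) (hδ : 0 ≤ δ)
    (v : ℕ → ℕ → ℝ)
    (hrel : ∀ s t, s + 1 ≤ l → s + 1 ≤ t → t + 1 ≤ m →
      |v (s + 1) t + v (s + 1) (t + 1) + v s t| ≤ δ)
    (S : Finset (ℕ × ℕ)) (hS : ∀ s t, s ≤ l → s ≤ t → t ≤ m → δ ≤ |v s t| → (s, t) ∈ S)
    (hbig : ∀ t, 1 ≤ t → t + 1 ≤ m → 331776 ^ (2 * l) * δ ≤ |v 0 t|) :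
    (m + 2) * (l + 1) ≤ 606208 * #S := by
  rcases lt_or_ge l 2 with hl | hl
  · have hsub : (Ico 1 m).image (fun t => (0, t)) ⊆ S := by
      intro x hx
      obtain ⟨t, ht, rfl⟩ := mem_image.1 hx
      rw [mem_Ico] at ht
      refine hS 0 t (by omega) (by omega) (by omega) (le_trans ?_ (hbig t (by omega) (by omega)))
      exact le_mul_of_one_le_left hδ (one_le_pow₀ (by norm_num))
    have := card_le_card hsub
    rw [card_image_of_injective _ (Prod.mk_right_injective 0), Nat.card_Ico] at this
    have h2 : (m + 2) * (l + 1) ≤ (m + 2) * 2 := Nat.mul_le_mul le_rfl (by omega)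
    omega
  · set q := (m + 1) / (l + 1) with hq
    have hql : q * (l + 1) ≤ m + 1 := Nat.div_mul_le_self _ _
    have hcount := card_mul_le_card_of_le_card_fiber S (fun x => x.2 / (l + 1)) (range q)
      (((l + 1) ^ 2 + 151551) / 151552) (by
        intro i hi
        have hi : (i + 1) * (l + 1) ≤ q * (l + 1) :=
          Nat.mul_le_mul (mem_range.1 hi) le_rfl
        rw [add_one_mul] at hi
        have := sq_le_card_large m l δ hδ v hrel (i * (l + 1) + l / 2) (by omega) (by omega)
          (S.filter (·.2 / (l + 1) = i)) (by
            intro s t hs hst ht ht' h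
            refine mem_filter.2 ⟨hS s t hs hst (by omega) h, ?_⟩
            refine Nat.div_eq_of_lt_le (by omega) ?_
            rw [add_one_mul]
            omega) (hbig _ (by omega) (by omega))
        omega)
    rw [card_range] at hcount
    have hq1 : m + 1 < (q + 1) * (l + 1) := by
      have := Nat.lt_div_mul_add (a := m + 1) (b := l + 1) (by omega)
      rw [add_one_mul]
      exact this
    have hq0 : 1 ≤ q := Nat.div_pos (by omega) (by omega)
    have hq2 : m + 2 ≤ 2 * q * (l + 1) := by nlinarith
    have hsq : (l + 1) ^ 2 ≤ 151552 * (((l + 1) ^ 2 + 151551) / 151552) := by omega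
    calc (m + 2) * (l + 1) ≤ 2 * q * (l + 1) * (l + 1) := Nat.mul_le_mul hq2 le_rfl
      _ = 2 * q * (l + 1) ^ 2 := by ring
      _ ≤ 2 * q * (151552 * (((l + 1) ^ 2 + 151551) / 151552)) := Nat.mul_le_mul le_rfl hsq
      _ = 303104 * (q * (((l + 1) ^ 2 + 151551) / 151552)) := by ring
      _ ≤ 303104 * #S := Nat.mul_le_mul le_rfl hcount
      _ ≤ 606208 * #S := by omega

/-- The point of the trapezoid with corner `a` in row `s` and with horizontal coordinate `t`. -/
noncomputable def latticePoint (a : ℝ × ℝ) (x : ℕ × ℕ) : ℝ × ℝ :=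
  a - (x.2 : ℝ) • xiv - (x.1 : ℝ) • etav

theorem latticePoint_injective (a : ℝ × ℝ) : Function.Injective (latticePoint a) := by
  rintro ⟨s, t⟩ ⟨s', t'⟩ h
  have h3 : Real.sqrt 3 ≠ 0 := by simp
  have h1 := congrArg Prod.fst h
  have h2 := congrArg Prod.snd h
  simp only [latticePoint, xiv, etav, Prod.fst_sub, Prod.snd_sub, Prod.smul_fst, Prod.smul_snd,
    smul_eq_mul] at h1 h2
  have hs : (s : ℝ) = s' := by
    have : ((s : ℝ) - s') * Real.sqrt 3 = 0 := by linarith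
    rcases mul_eq_zero.1 this with h | h
    · linarith
    · exact absurd h h3
  have ht : (t : ℝ) = t' := by
    rw [hs] at h1
    linarith
  exact Prod.ext (by exact_mod_cast hs) (by exact_mod_cast ht)

theorem mem_PrSet_iff (a : ℝ × ℝ) (m l : ℕ) (p : ℝ × ℝ) :
    p ∈ PrSet a m l ↔ ∃ x : ℕ × ℕ, x.1 ≤ l ∧ x.1 ≤ x.2 ∧ x.2 ≤ m ∧ p = latticePoint a x := by
  constructor
  · rintro ⟨s, t, hs0, hs, hst, ht, rfl⟩
    lift s to ℕ using hs0
    lift t to ℕ using by omega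
    exact ⟨(s, t), by omega, by omega, by omega, by simp [latticePoint]⟩
  · rintro ⟨⟨s, t⟩, hs, hst, ht, rfl⟩
    exact ⟨s, t, by omega, by exact_mod_cast hs, by exact_mod_cast hst, by exact_mod_cast ht,
      by simp [latticePoint]⟩

theorem latticePoint_mem_PrSet {a : ℝ × ℝ} {m l s t : ℕ} (hs : s ≤ l) (hst : s ≤ t) (ht : t ≤ m) :
    latticePoint a (s, t) ∈ PrSet a m l :=
  (mem_PrSet_iff a m l _).2 ⟨(s, t), hs, hst, ht, rfl⟩

theorem finite_PrSet (a : ℝ × ℝ) (m l : ℕ) : (PrSet a m l).Finite := by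
  refine ((range (l + 1) ×ˢ range (m + 1)).finite_toSet.image (latticePoint a)).subset ?_
  intro p hp
  obtain ⟨x, h1, h2, h3, rfl⟩ := (mem_PrSet_iff a m l p).1 hp
  refine ⟨x, ?_, rfl⟩
  simp only [coe_product, Set.mem_prod, mem_coe, mem_range]
  omega

/-- Lower bound on the number of "large" points of a reversed trapezoid, relative to
the minimum of `|u|` over a subset `L` of its upper edge. -/
theorem reversed_trapezoid_many_large_points :
    ∃ C₄ : ℝ, 5 < C₄ ∧ ∃ ε₃ : ℝ, 0 < ε₃ ∧
      ∀ (a : ℝ × ℝ), a ∈ Lam → ∀ m l : ℕ, l ≤ m →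
        ∀ L : Set (ℝ × ℝ), L.Nonempty → L ⊆ PrUpperEdge a m →
          ∀ u : ℝ × ℝ → ℝ,
            (∀ b, b ∈ PrSet a m l → b - xiv ∈ PrSet a m l → b + etav ∈ PrSet a m l →
              |u b + u (b - xiv) + u (b + etav)| ≤
                C₄ ^ (-2 * (l : ℤ)) * sInf ((fun c => |u c|) '' L)) →
            ((L = {a - ((m / 2 : ℕ) : ℝ) • xiv} ∨ L = {a - (((m + 1) / 2 : ℕ) : ℝ) • xiv} →
              ε₃ * ((l : ℝ) + 1) ^ 2 ≤
                (({b | b ∈ PrSet a m l ∧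
                  C₄ ^ (-2 * (l : ℤ)) * sInf ((fun c => |u c|) '' L) ≤ |u b|}).ncard : ℝ)) ∧
            (2 ≤ m →
              L = {p | ∃ t : ℤ, 1 ≤ t ∧ t ≤ (m : ℤ) - 1 ∧ p = a - (t : ℝ) • xiv} →
              ε₃ * ((m : ℝ) + 2) * ((l : ℝ) + 1) ≤
                (({b | b ∈ PrSet a m l ∧
                  C₄ ^ (-2 * (l : ℤ)) * sInf ((fun c => |u c|) '' L) ≤ |u b|}).ncard : ℝ))) := by
  refine ⟨331776, by norm_num, 1 / 606208, by norm_num, ?_⟩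
  intro a _ m l hlm L _ _ u hu
  set M := sInf ((fun c => |u c|) '' L) with hM
  set δ := (331776 : ℝ) ^ (-2 * (l : ℤ)) * M with hδ
  have hbdd : BddBelow ((fun c => |u c|) '' L) := ⟨0, by rintro _ ⟨c, _, rfl⟩; exact abs_nonneg _⟩
  have hM0 : 0 ≤ M := Real.sInf_nonneg (by rintro _ ⟨c, _, rfl⟩; exact abs_nonneg _)
  have hδ0 : 0 ≤ δ := mul_nonneg (by positivity) hM0
  have hδM : (331776 : ℝ) ^ (2 * l) * δ = M := by
    rw [hδ, ← mul_assoc, ← zpow_natCast, ← zpow_add₀ (by norm_num)]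
    simp
  set v : ℕ → ℕ → ℝ := fun s t => u (latticePoint a (s, t)) with hv
  have hrel : ∀ s t, s + 1 ≤ l → s + 1 ≤ t → t + 1 ≤ m →
      |v (s + 1) t + v (s + 1) (t + 1) + v s t| ≤ δ := by
    intro s t hs hst ht
    have hξ : latticePoint a (s + 1, t) - xiv = latticePoint a (s + 1, t + 1) := by
      simp only [latticePoint]
      push_cast
      module
    have hη : latticePoint a (s + 1, t) + etav = latticePoint a (s, t) := by
      simp only [latticePoint]
      push_cast
      module
    have := hu (latticePoint a (s + 1, t)) (latticePoint_mem_PrSet hs hst (by omega))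
      (by rw [hξ]; exact latticePoint_mem_PrSet hs (by omega) ht)
      (by rw [hη]; exact latticePoint_mem_PrSet (by omega) (by omega) (by omega))
    rwa [hξ, hη] at this
  have hbig : ∀ t : ℕ, a - (t : ℝ) • xiv ∈ L → 331776 ^ (2 * l) * δ ≤ |v 0 t| := by
    intro t ht
    rw [hδM]
    refine csInf_le hbdd ⟨_, ht, ?_⟩
    simp [hv, latticePoint]
  classical
  set S := (range (l + 1) ×ˢ range (m + 1)).filter fun x => x.1 ≤ x.2 ∧ δ ≤ |v x.1 x.2| with hSdef
  have hS : ∀ s t, s ≤ l → s ≤ t → t ≤ m → δ ≤ |v s t| → (s, t) ∈ S := by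
    intro s t hs hst ht h
    simp only [hSdef, mem_filter, mem_product, mem_range]
    exact ⟨by omega, hst, h⟩
  have hcard : (#S : ℝ) ≤ (({b | b ∈ PrSet a m l ∧ δ ≤ |u b|}).ncard : ℝ) := by
    rw [← card_image_of_injective S (latticePoint_injective a), ← Set.ncard_coe_finset]
    refine Nat.cast_le.2 (Set.ncard_le_ncard ?_ ((finite_PrSet a m l).subset fun b hb => hb.1))
    intro b hb
    obtain ⟨⟨s, t⟩, hx, rfl⟩ := mem_image.1 (mem_coe.1 hb)
    simp only [hSdef, mem_filter, mem_product, mem_range] at hx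
    exact ⟨latticePoint_mem_PrSet (by omega) hx.2.1 (by omega), hx.2.2⟩
  constructor
  · intro hL
    obtain ⟨c, hcL, hc, hcm⟩ : ∃ c : ℕ, a - (c : ℝ) • xiv ∈ L ∧ l / 2 ≤ c ∧ c + l / 2 ≤ m := by
      rcases hL with hL | hL
      · exact ⟨m / 2, by rw [hL]; rfl, by omega, by omega⟩
      · exact ⟨(m + 1) / 2, by rw [hL]; rfl, by omega, by omega⟩
    have h := sq_le_card_large m l δ hδ0 v hrel c hc hcm S
      (fun s t hs hst _ ht h => hS s t hs hst (by omega) h) (hbig c hcL)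
    have h : ((l : ℝ) + 1) ^ 2 ≤ 151552 * #S := by exact_mod_cast h
    have h0 : (0 : ℝ) ≤ #S := Nat.cast_nonneg _
    linarith
  · intro hm hL
    have h := mul_le_card_large m l hlm hm δ hδ0 v hrel S hS fun t ht ht' => hbig t (by
      rw [hL]
      exact ⟨t, by omega, by omega, by simp⟩)
    have h : ((m : ℝ) + 2) * ((l : ℝ) + 1) ≤ 606208 * #S := by exact_mod_cast h
    linarith
end

section
/- Let K > 0, n ∈ ℤ₊, and let u, V : ℤ³ → ℝ satisfy Δu(a) = V(a)·u(a) for all a ∈ Q_n and ‖V‖_∞ ≤ K. Then there exists τ ∈ {1,2,3,4} such that for every integer i with 0 ≤ i ≤ n/10 there is a point a_i ∈ (𝒫_{τ,i} ∪ 𝒫_{τ,i+1}) ∩ 𝒞 ∩ Q_{n/10 + 1} with |u(a_i)| ≥ (K+11)^{-n}·|u(0)|. -/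
/-- The standard basis vectors of `ℤ³`. -/
def stdv (i : Fin 3) : Fin 3 → ℤ := fun j => if j = i then 1 else 0

/-- The discrete Laplacian on `ℤ³`:
`Δu(a) = -6 u(a) + ∑_{|a-b|=1} u(b)`. -/
noncomputable def discLap (u : (Fin 3 → ℤ) → ℝ) (a : Fin 3 → ℤ) : ℝ :=
  -6 * u a + ∑ i : Fin 3, (u (a + stdv i) + u (a - stdv i))

/-- The cube `Q_r(a) = a + ([-r, r] ∩ ℤ)³`. -/
def cube (a : Fin 3 → ℤ) (r : ℝ) : Set (Fin 3 → ℤ) :=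
  {b | ∀ i, |((b i - a i : ℤ) : ℝ)| ≤ r}

/-- The four diagonal vectors `λ₁ = e₁+e₂+e₃`, `λ₂ = -e₁+e₂+e₃`, `λ₃ = e₁-e₂+e₃`,
`λ₄ = -e₁-e₂+e₃`. -/
def lamv : Fin 4 → (Fin 3 → ℤ) := ![![1, 1, 1], ![-1, 1, 1], ![1, -1, 1], ![-1, -1, 1]]

/-- Dot product on `ℤ³`. -/
def zdot (a b : Fin 3 → ℤ) : ℤ := ∑ i, a i * b i

/-- The cone `𝒞 = 𝒞_0^3 = {b ∈ ℤ³ : |b·e₃| ≥ |b·e₁| + |b·e₂|}`. -/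
def coneC : Set (Fin 3 → ℤ) := {b | |b 0| + |b 1| ≤ |b 2|}

theorem zdot_lamv (b : Fin 3 → ℤ) :
    zdot b (lamv 0) = b 0 + b 1 + b 2 ∧ zdot b (lamv 1) = -b 0 + b 1 + b 2 ∧
    zdot b (lamv 2) = b 0 - b 1 + b 2 ∧ zdot b (lamv 3) = -b 0 - b 1 + b 2 := by
  simp [zdot, lamv, Fin.sum_univ_three]
  omega

/-- The upward neighbours of `a`: those appearing, besides `a`, in the equation at `a + e₃`. -/
def IsUpStep (a b : Fin 3 → ℤ) : Prop :=
  (b 0 = a 0 ∧ b 1 = a 1 ∧ b 2 = a 2 + 1) ∨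
  (b 0 = a 0 ∧ b 1 = a 1 ∧ b 2 = a 2 + 2) ∨
  (b 0 = a 0 + 1 ∧ b 1 = a 1 ∧ b 2 = a 2 + 1) ∨
  (b 0 = a 0 - 1 ∧ b 1 = a 1 ∧ b 2 = a 2 + 1) ∨
  (b 0 = a 0 ∧ b 1 = a 1 + 1 ∧ b 2 = a 2 + 1) ∨
  (b 0 = a 0 ∧ b 1 = a 1 - 1 ∧ b 2 = a 2 + 1)

theorem IsUpStep.zdot_le {a b : Fin 3 → ℤ} (h : IsUpStep a b) (τ : Fin 4) :
    zdot b (lamv τ) ≤ zdot a (lamv τ) + 2 := by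
  have ha := zdot_lamv a
  have hb := zdot_lamv b
  unfold IsUpStep at h
  fin_cases τ <;> simp only [Fin.zero_eta, Fin.mk_one, Fin.reduceFinMk] <;> omega

theorem abs_apply_le_of_cone {b : Fin 3 → ℤ} {m : ℤ} (hb : |b 0| + |b 1| ≤ b 2) (hm : b 2 ≤ m)
    (j : Fin 3) : |b j| ≤ m := by
  have h0 := abs_nonneg (b 0)
  have h1 := abs_nonneg (b 1)
  have h2 : |b 2| = b 2 := abs_of_nonneg (by omega)
  fin_cases j <;> simp only [Fin.zero_eta, Fin.mk_one, Fin.reduceFinMk] <;> omega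

theorem IsUpStep.cone {a b : Fin 3 → ℤ} (h : IsUpStep a b) (ha : |a 0| + |a 1| ≤ a 2) :
    |b 0| + |b 1| ≤ b 2 := by
  simp only [abs_eq_max_neg] at ha ⊢
  unfold IsUpStep at h
  omega

/-- One of the upward neighbours of `a` carries a definite fraction of `|u a|`. -/
theorem exists_isUpStep_le {K : ℝ} {u : (Fin 3 → ℤ) → ℝ} {v : ℝ} (a : Fin 3 → ℤ)
    (hu : discLap u (a + stdv 2) = v * u (a + stdv 2)) (hv : |v| ≤ K) :
    ∃ b, IsUpStep a b ∧ |u a| ≤ (K + 11) * |u b| := by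
  by_contra! hcon
  have hK : 0 ≤ K := (abs_nonneg v).trans hv
  have hpos : 0 < K + 11 := by linarith
  have h0 := hcon (a + stdv 2) (by simp [IsUpStep, stdv])
  have h1 := hcon (a + stdv 2 + stdv 2) (by simp [IsUpStep, stdv]; omega)
  have h2 := hcon (a + stdv 2 + stdv 0) (by simp [IsUpStep, stdv])
  have h3 := hcon (a + stdv 2 - stdv 0) (by simp [IsUpStep, stdv])
  have h4 := hcon (a + stdv 2 + stdv 1) (by simp [IsUpStep, stdv])
  have h5 := hcon (a + stdv 2 - stdv 1) (by simp [IsUpStep, stdv])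
  simp only [discLap, Fin.sum_univ_three, add_sub_cancel_right] at hu
  set x := u a
  set x0 := u (a + stdv 2)
  set x1 := u (a + stdv 2 + stdv 2)
  set x2 := u (a + stdv 2 + stdv 0)
  set x3 := u (a + stdv 2 - stdv 0)
  set x4 := u (a + stdv 2 + stdv 1)
  set x5 := u (a + stdv 2 - stdv 1)
  have hx : x = (6 + v) * x0 - x1 - x2 - x3 - x4 - x5 := by linarith
  have hv0 : |(6 + v) * x0| ≤ (K + 6) * |x0| := by
    rw [abs_mul]
    gcongr
    rw [abs_le] at hv ⊢
    constructor <;> linarith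
  have hle : |x| ≤ (K + 6) * |x0| + |x1| + |x2| + |x3| + |x4| + |x5| := by
    rw [hx]
    have t1 := abs_sub ((6 + v) * x0 - x1 - x2 - x3 - x4) x5
    have t2 := abs_sub ((6 + v) * x0 - x1 - x2 - x3) x4
    have t3 := abs_sub ((6 + v) * x0 - x1 - x2) x3
    have t4 := abs_sub ((6 + v) * x0 - x1) x2
    have t5 := abs_sub ((6 + v) * x0) x1
    linarith
  have h0' := mul_lt_mul_of_pos_left h0 (by linarith : 0 < K + 6)
  have hmul := mul_le_mul_of_nonneg_left hle hpos.le
  nlinarith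

/-- Climbing to height `k` inside the cone: the endpoint `a`, and every slab below it in each of the
diagonal directions, is visited at a point carrying a definite fraction of `|u 0|`. -/
theorem exists_upward_path {K : ℝ} {n : ℕ} {u V : (Fin 3 → ℤ) → ℝ}
    (hu : ∀ a ∈ cube 0 (n : ℝ), discLap u a = V a * u a)
    (hV : ∀ a, |V a| ≤ K) (k : ℕ) (hk : k ≤ n) :
    ∃ a : Fin 3 → ℤ, (k : ℤ) ≤ a 2 ∧ a 2 ≤ k + 1 ∧ |a 0| + |a 1| ≤ a 2 ∧
      |u 0| ≤ (K + 11) ^ k * |u a| ∧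
      ∀ τ, ∀ i : ℕ, (i : ℤ) ≤ zdot a (lamv τ) → ∃ b : Fin 3 → ℤ,
        (zdot b (lamv τ) = (i : ℤ) ∨ zdot b (lamv τ) = (i : ℤ) + 1) ∧
        |b 0| + |b 1| ≤ b 2 ∧ b 2 ≤ k + 1 ∧ |u 0| ≤ (K + 11) ^ k * |u b| := by
  have hK : 0 ≤ K := (abs_nonneg _).trans (hV 0)
  have hC : 1 ≤ K + 11 := by linarith
  induction k with
  | zero =>
    refine ⟨0, by simp, by simp, by simp, by simp, fun τ i hi => ⟨0, ?_, by simp, by simp, by simp⟩⟩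
    simp only [zdot, Pi.zero_apply, zero_mul, Finset.sum_const_zero] at hi ⊢
    omega
  | succ k ih =>
    obtain ⟨a, ha1, ha2, hcone, hua, hslab⟩ := ih (by omega)
    have hmono (x : ℝ) : (K + 11) ^ k * |x| ≤ (K + 11) ^ (k + 1) * |x| := by
      gcongr
      omega
    have hslab' : ∀ τ, ∀ i : ℕ, (i : ℤ) ≤ zdot a (lamv τ) → ∃ b : Fin 3 → ℤ,
        (zdot b (lamv τ) = (i : ℤ) ∨ zdot b (lamv τ) = (i : ℤ) + 1) ∧
        |b 0| + |b 1| ≤ b 2 ∧ b 2 ≤ (k + 1 : ℕ) + 1 ∧ |u 0| ≤ (K + 11) ^ (k + 1) * |u b| := by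
      intro τ i hi
      obtain ⟨b, hb1, hb2, hb3, hb4⟩ := hslab τ i hi
      exact ⟨b, hb1, hb2, by push_cast; omega, hb4.trans (hmono _)⟩
    by_cases hz : (k : ℤ) + 1 ≤ a 2
    · exact ⟨a, by push_cast; omega, by push_cast; omega, hcone, hua.trans (hmono _), hslab'⟩
    have hmem : a + stdv 2 ∈ cube 0 (n : ℝ) := by
      intro j
      have hup : IsUpStep a (a + stdv 2) := by simp [IsUpStep, stdv]
      have hj := abs_apply_le_of_cone (m := n) (hup.cone hcone) (by simp [stdv]; omega) j
      simp only [Pi.zero_apply, sub_zero]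
      exact_mod_cast hj
    obtain ⟨b, hstep, hub⟩ := exists_isUpStep_le a (hu _ hmem) (hV _)
    have hub' : |u 0| ≤ (K + 11) ^ (k + 1) * |u b| := by
      rw [pow_succ, mul_assoc]
      exact hua.trans (by gcongr)
    have hz1 : ((k + 1 : ℕ) : ℤ) ≤ b 2 := by unfold IsUpStep at hstep; push_cast; omega
    have hz2 : b 2 ≤ ((k + 1 : ℕ) : ℤ) + 1 := by unfold IsUpStep at hstep; push_cast; omega
    have hbcone : |b 0| + |b 1| ≤ b 2 := hstep.cone hcone
    refine ⟨b, hz1, hz2, hbcone, hub', fun τ i hi => ?_⟩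
    by_cases hia : (i : ℤ) ≤ zdot a (lamv τ)
    · exact hslab' τ i hia
    · have := hstep.zdot_le τ
      exact ⟨b, by omega, hbcone, hz2, hub'⟩

/-- There is a direction `τ` such that every slab `𝒫_{τ,i} ∪ 𝒫_{τ,i+1}` with
`0 ≤ i ≤ n/10` carries a point of the cone `𝒞 ∩ Q_{n/10+1}` where `|u|` is at least
`(K+11)^{-n} |u(0)|`. -/
theorem plane_points_in_cone (K : ℝ) (hK : 0 < K) (n : ℕ) (hn : 0 < n)
    (u V : (Fin 3 → ℤ) → ℝ)
    (hu : ∀ a ∈ cube 0 (n : ℝ), discLap u a = V a * u a)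
    (hV : ∀ a, |V a| ≤ K) :
    ∃ τ : Fin 4, ∀ i : ℕ, (i : ℝ) ≤ (n : ℝ) / 10 →
      ∃ b : Fin 3 → ℤ,
        (zdot b (lamv τ) = (i : ℤ) ∨ zdot b (lamv τ) = (i : ℤ) + 1) ∧
        b ∈ coneC ∧ b ∈ cube 0 ((n : ℝ) / 10 + 1) ∧
        (K + 11) ^ (-(n : ℤ)) * |u 0| ≤ |u b| := by
  have hC : 1 ≤ K + 11 := by linarith
  obtain ⟨a, ha, -, -, -, hslab⟩ := exists_upward_path hu hV (n / 10) (by omega)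
  have hτ : ∃ τ, ((n / 10 : ℕ) : ℤ) ≤ zdot a (lamv τ) := by
    by_contra! h
    have h0 := h 0
    have h1 := h 1
    have h2 := h 2
    have h3 := h 3
    have := zdot_lamv a
    omega
  obtain ⟨τ, hτ⟩ := hτ
  refine ⟨τ, fun i hi => ?_⟩
  have hi' : i ≤ n / 10 := by
    rw [Nat.le_div_iff_mul_le (by norm_num)]
    rw [le_div_iff₀ (by norm_num)] at hi
    exact_mod_cast hi
  obtain ⟨b, hb, hcone, hz, hub⟩ := hslab τ i (by omega)
  refine ⟨b, hb, ?_, fun j => ?_, ?_⟩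
  · exact hcone.trans (le_abs_self _)
  · have hj : (|b j| : ℝ) ≤ ((n / 10 : ℕ) : ℝ) + 1 := by
      have := Int.cast_le (R := ℝ).mpr (abs_apply_le_of_cone hcone hz j)
      rwa [Int.cast_abs, Int.cast_add, Int.cast_one, Int.cast_natCast] at this
    have hdiv : ((n / 10 : ℕ) : ℝ) ≤ (n : ℝ) / 10 := Nat.cast_div_le
    simp only [Pi.zero_apply, sub_zero]
    linarith
  · rw [zpow_neg, zpow_natCast, inv_mul_le_iff₀ (by positivity)]
    refine hub.trans ?_
    gcongr
    omega
end

section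
/- There exist universal constants β > 0 and α > 5/4 such that for any positive integers m ≤ n and any K > 0 the following holds. For all functions u, V : ℤ³ → ℝ with Δu(a) = V(a)·u(a) for every a ∈ Q_n and ‖V‖_∞ ≤ K, there is a subset Θ ⊂ Q_n with |Θ| ≥ β·(n/m)^α such that: (1) |u(b)| ≥ (K+11)^{-12n}·|u(0)| for each b ∈ Θ; (2) Q_m(b) ∩ Q_m(b') = ∅ for all distinct b, b' ∈ Θ; (3) Q_m(b) ⊂ Q_n for each b ∈ Θ. -/
/-- The cubes of radius `r` around `a` and `b` are disjoint. -/
def Separated (r : ℤ) (a b : Fin 3 → ℤ) : Prop :=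
  ∃ i, 2 * r < a i - b i ∨ 2 * r < b i - a i

/-- The cone around the ray spanned by `s • stdv i`, for a sign `s`. -/
def InCone (i : Fin 3) (s : ℤ) (v : Fin 3 → ℤ) : Prop :=
  ((v 0).natAbs + (v 1).natAbs + (v 2).natAbs : ℤ) ≤ 2 * (s * v i)

/-- The sup norm on `ℤ³`. -/
def supNorm (v : Fin 3 → ℤ) : ℤ :=
  max ((v 0).natAbs : ℤ) (max ((v 1).natAbs : ℤ) ((v 2).natAbs : ℤ))

/-- A point of the cone in direction `s • stdv i` at height `L` or `L + 1`. -/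
def AtHeight (i : Fin 3) (s L : ℤ) (q : Fin 3 → ℤ) : Prop :=
  InCone i s q ∧ L ≤ s * q i ∧ s * q i ≤ L + 1

/-- The set `A` contains at least `k` pairwise separated points. -/
def Packs (r : ℤ) (A : Set (Fin 3 → ℤ)) (k : ℕ) : Prop :=
  ∃ Θ : Finset (Fin 3 → ℤ), (↑Θ : Set (Fin 3 → ℤ)) ⊆ A ∧ k ≤ Θ.card ∧
    ∀ a ∈ Θ, ∀ b ∈ Θ, a ≠ b → Separated r a b

lemma Separated.symm {r : ℤ} {a b : Fin 3 → ℤ} (h : Separated r a b) : Separated r b a := by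
  obtain ⟨i, hi⟩ := h
  exact ⟨i, hi.symm⟩

lemma sep_of_sign {r s : ℤ} (hs : s = 1 ∨ s = -1) {a b : Fin 3 → ℤ} (i : Fin 3)
    (h : 2 * r < s * a i - s * b i) : Separated r a b := by
  refine ⟨i, ?_⟩
  rcases hs with rfl | rfl <;> omega

lemma le_of_not_sep {r s : ℤ} (hs : s = 1 ∨ s = -1) {a b : Fin 3 → ℤ} (h : ¬ Separated r a b)
    (i : Fin 3) : s * a i - s * b i ≤ 2 * r := by
  by_contra! hlt
  exact h (sep_of_sign hs i hlt)

lemma sep_of_supNorm {r : ℤ} {a b : Fin 3 → ℤ} (h : 2 * r < supNorm b - supNorm a) :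
    Separated r a b := by
  by_contra hn
  have h1 := fun i => le_of_not_sep (Or.inl rfl) hn i
  have h2 := fun i => le_of_not_sep (Or.inr rfl) hn i
  have := h1 0; have := h1 1; have := h1 2; have := h2 0; have := h2 1; have := h2 2
  unfold supNorm at h
  omega

lemma Packs.mono {r : ℤ} {A B : Set (Fin 3 → ℤ)} {k : ℕ} (h : Packs r A k) (hAB : A ⊆ B) :
    Packs r B k := by
  obtain ⟨Θ, h1, h2⟩ := h
  exact ⟨Θ, h1.trans hAB, h2⟩

lemma packs_singleton (r : ℤ) (a : Fin 3 → ℤ) : Packs r {a} 1 :=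
  ⟨{a}, by simp, by simp, by simp⟩

lemma Packs.union {r : ℤ} (hr : 0 ≤ r) {A B : Set (Fin 3 → ℤ)} {k l : ℕ} (hA : Packs r A k)
    (hB : Packs r B l) (hAB : ∀ a ∈ A, ∀ b ∈ B, Separated r a b) : Packs r (A ∪ B) (k + l) := by
  classical
  obtain ⟨Θ, h1, h2, h3⟩ := hA
  obtain ⟨Ξ, g1, g2, g3⟩ := hB
  refine ⟨Θ ∪ Ξ, ?_, ?_, ?_⟩
  · rw [Finset.coe_union]
    exact Set.union_subset_union h1 g1
  · rw [Finset.card_union_of_disjoint]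
    · omega
    · rw [Finset.disjoint_left]
      intro a ha hb
      obtain ⟨i, hi⟩ := hAB a (h1 ha) a (g1 hb)
      omega
  · intro a ha b hb hne
    rcases Finset.mem_union.1 ha with ha | ha <;> rcases Finset.mem_union.1 hb with hb | hb
    · exact h3 a ha b hb hne
    · exact hAB a (h1 ha) b (g1 hb)
    · exact (hAB b (h1 hb) a (g1 ha)).symm
    · exact g3 a ha b hb hne

lemma packs_pair {r : ℤ} (hr : 0 ≤ r) {A : Set (Fin 3 → ℤ)} {a b : Fin 3 → ℤ} (ha : a ∈ A)
    (hb : b ∈ A) (h : Separated r a b) : Packs r A 2 := by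
  refine ((packs_singleton r a).union hr (packs_singleton r b) ?_).mono ?_
  · rintro x rfl y rfl
    exact h
  · rintro x (rfl | rfl) <;> assumption

lemma packs_triple {r : ℤ} (hr : 0 ≤ r) {A : Set (Fin 3 → ℤ)} {a b c : Fin 3 → ℤ} (ha : a ∈ A)
    (hb : b ∈ A) (hc : c ∈ A) (hab : Separated r a b) (hac : Separated r a c)
    (hbc : Separated r b c) : Packs r A 3 := by
  refine ((packs_pair hr (A := {a, b}) (by simp) (by simp) hab).union hr
    (packs_singleton r c) ?_).mono ?_
  · rintro x (rfl | rfl) y rfl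
    · exact hac
    · exact hbc
  · rintro x ((rfl | rfl) | rfl) <;> assumption

/-- The points of `S` with sup norm between `L` and `M`. -/
def shell (S : Set (Fin 3 → ℤ)) (L M : ℤ) : Set (Fin 3 → ℤ) :=
  {q | q ∈ S ∧ L ≤ supNorm q ∧ supNorm q ≤ M}

lemma Packs.union_shell {S : Set (Fin 3 → ℤ)} {r L M L' M' : ℤ} (hr : 0 ≤ r) {k l : ℕ}
    (h : Packs r (shell S L M) k) (h' : Packs r (shell S L' M') l) (hML : M + 2 * r < L')
    (hL : L ≤ L') (hM : M ≤ M') : Packs r (shell S L M') (k + l) := by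
  refine (h.union hr h' ?_).mono ?_
  · rintro a ⟨-, -, ha⟩ b ⟨-, hb, -⟩
    exact sep_of_supNorm (by omega)
  · rintro a (⟨h1, h2, h3⟩ | ⟨h1, h2, h3⟩)
    · exact ⟨h1, h2, by omega⟩
    · exact ⟨h1, by omega, h3⟩

section Cone

variable {i j : Fin 3} {s σ : ℤ} {v w : Fin 3 → ℤ}

lemma InCone.abs_le (hs : s = 1 ∨ s = -1) (hσ : σ = 1 ∨ σ = -1) (h : InCone i s v)
    (j : Fin 3) : σ * v j ≤ s * v i := by
  unfold InCone at h
  fin_cases i <;> fin_cases j <;> rcases hs with rfl | rfl <;> rcases hσ with rfl | rfl <;>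
    simp only [Fin.zero_eta, Fin.mk_one, Fin.reduceFinMk] at * <;> omega

lemma InCone.add_le {k : Fin 3} {τ : ℤ} (hs : s = 1 ∨ s = -1) (hσ : σ = 1 ∨ σ = -1)
    (hτ : τ = 1 ∨ τ = -1) (h : InCone i s v) (hij : i ≠ j) (hik : i ≠ k) (hjk : j ≠ k) :
    σ * v j + τ * v k ≤ s * v i := by
  unfold InCone at h
  have hp : ∀ {ε : ℤ}, (ε = 1 ∨ ε = -1) → ∀ x : ℤ, ε * x ≤ x.natAbs := by
    rintro ε (rfl | rfl) x <;> omega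
  have h1 := hp hs (v i)
  have h2 := hp hσ (v j)
  have h3 := hp hτ (v k)
  have h4 : ((v i).natAbs : ℤ) + (v j).natAbs + (v k).natAbs ≤ 2 * (s * v i) := by
    fin_cases i <;> fin_cases j <;> fin_cases k <;>
      first
      | exact absurd rfl hij
      | exact absurd rfl hik
      | exact absurd rfl hjk
      | (simp only [Fin.zero_eta, Fin.mk_one, Fin.reduceFinMk] at h ⊢; omega)
  have h5 : s * v i = (v i).natAbs := by
    rcases hs with rfl | rfl <;> omega
  omega

lemma InCone.add (hv : InCone i s v) (hw : InCone i s w) : InCone i s (v + w) := by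
  unfold InCone at *
  simp only [Pi.add_apply, mul_add]
  omega

lemma InCone.supNorm_eq (hs : s = 1 ∨ s = -1) (h : InCone i s v) : supNorm v = s * v i := by
  unfold InCone at h
  unfold supNorm
  fin_cases i <;> rcases hs with rfl | rfl <;>
    simp only [Fin.zero_eta, Fin.mk_one, Fin.reduceFinMk] at * <;> omega

lemma AtHeight.mem_shell {S : Set (Fin 3 → ℤ)} {L : ℤ} (hs : s = 1 ∨ s = -1)
    (h : AtHeight i s L v) (hv : v ∈ S) : v ∈ shell S L (L + 1) := by
  refine ⟨hv, ?_⟩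
  rw [h.1.supNorm_eq hs]
  exact h.2

lemma AtHeight.sep_opposite {r L : ℤ} (hs : s = 1 ∨ s = -1) (hv : AtHeight i s L v)
    (hw : AtHeight i (-s) L w) (hL : r < L) : Separated r v w := by
  refine sep_of_sign hs i ?_
  have := hv.2.1
  have h2 := hw.2.1
  rw [neg_mul] at h2
  omega

end Cone

/-- Among three points at the same height in the cones around three different axes, two are
separated. -/
lemma exists_sep_of_atHeight {r L : ℤ} {s : Fin 3 → ℤ} (hs : ∀ i, s i = 1 ∨ s i = -1)
    {q : Fin 3 → Fin 3 → ℤ} (hq : ∀ i, AtHeight i (s i) L (q i)) (hL : 4 * r + 1 < L) :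
    ∃ i j, i ≠ j ∧ Separated r (q i) (q j) := by
  by_contra! hn
  have h1 := le_of_not_sep (hs 1) (fun h => hn 0 1 (by decide) h.symm) 1
  have h2 := le_of_not_sep (hs 2) (fun h => hn 0 2 (by decide) h.symm) 2
  have h01 := (hq 1).2.1
  have h02 := (hq 2).2.1
  have h00 := (hq 0).2.2
  have hc := (hq 0).1.add_le (hs 0) (hs 1) (hs 2) (j := 1) (k := 2) (by decide) (by decide)
    (by decide)
  omega

/-- The sign pattern: either a shell contains three separated points, or the six points
in the cones cluster in two opposite octants. -/
lemma exists_signs {S : Set (Fin 3 → ℤ)} {r L c : ℤ} (hr : 0 ≤ r) (hc : 0 < c)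
    (hL : 2 * r + c ≤ L) {D : Fin 3 → ℤ → Fin 3 → ℤ}
    (hDS : ∀ i s, s = 1 ∨ s = -1 → D i s ∈ S)
    (hD : ∀ i s, s = 1 ∨ s = -1 → AtHeight i s L (D i s))
    (hbad : ¬ Packs r (shell S L (L + 1)) 3) :
    ∃ s : Fin 3 → ℤ, (∀ i, s i = 1 ∨ s i = -1) ∧
      (∀ i j, i ≠ j → c ≤ s j * D i (s i) j) ∧
      (∀ i j, i ≠ j → c ≤ -s j * D i (-s i) j) := by
  have hmem : ∀ i s, s = 1 ∨ s = -1 → D i s ∈ shell S L (L + 1) :=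
    fun i s hs => (hD i s hs).mem_shell hs (hDS i s hs)
  have pos : (1 : ℤ) = 1 ∨ (1 : ℤ) = -1 := Or.inl rfl
  have neg : (-1 : ℤ) = 1 ∨ (-1 : ℤ) = -1 := Or.inr rfl
  have negs : ∀ s : ℤ, s = 1 ∨ s = -1 → -s = 1 ∨ -s = -1 := by omega
  have htri : ∀ i j k s s' s'', (s = 1 ∨ s = -1) → (s' = 1 ∨ s' = -1) → (s'' = 1 ∨ s'' = -1) →
      Separated r (D i s) (D j s') → Separated r (D i s) (D k s'') →
      ¬ Separated r (D j s') (D k s'') :=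
    fun i j k s s' s'' h h' h'' h1 h2 h3 =>
      hbad (packs_triple hr (hmem i s h) (hmem j s' h') (hmem k s'' h'') h1 h2 h3)
  have hopp : ∀ i, Separated r (D i 1) (D i (-1)) := fun i =>
    (hD i 1 pos).sep_opposite pos (hD i (-1) neg) (by omega)
  have hcoord : ∀ i j s s', (s = 1 ∨ s = -1) → (s' = 1 ∨ s' = -1) →
      ¬ Separated r (D i s) (D j s') → c ≤ s' * D i s j := by
    intro i j s s' _ hs' h
    have h1 := le_of_not_sep hs' (fun g => h (Separated.symm g)) j
    have h2 := (hD j s' hs').2.1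
    omega
  have hone : ∀ i j s s', (s = 1 ∨ s = -1) → (s' = 1 ∨ s' = -1) →
      ¬ Separated r (D i s) (D j s') → Separated r (D i s) (D j (-s')) := by
    intro i j s s' hs hs' h
    by_contra h'
    have h1 := hcoord i j s s' hs hs' h
    have h2 := hcoord i j s (-s') hs (negs _ hs') h'
    rw [neg_mul] at h2
    omega
  have hone' : ∀ i j s s', (s = 1 ∨ s = -1) → (s' = 1 ∨ s' = -1) →
      ¬ Separated r (D i s) (D j s') → Separated r (D i (-s)) (D j s') := fun i j s s' hs hs' h =>
    (hone j i s' s hs' hs fun g => h g.symm).symm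
  have hmatch : ∀ j, ∃ ε, (ε = 1 ∨ ε = -1) ∧ ¬ Separated r (D 0 1) (D j ε) ∧
      ¬ Separated r (D 0 (-1)) (D j (-ε)) := by
    intro j
    by_cases h : Separated r (D 0 1) (D j 1)
    · have h1 := htri 0 0 j 1 (-1) 1 pos neg pos (hopp 0) h
      have h2 := hone 0 j (-1) 1 neg pos h1
      refine ⟨-1, neg, fun h3 => ?_, by rwa [neg_neg]⟩
      exact htri 0 0 j 1 (-1) (-1) pos neg neg (hopp 0) h3 h2
    · refine ⟨1, pos, h, fun h3 => ?_⟩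
      exact htri 0 0 j 1 (-1) (-1) pos neg neg (hopp 0) (hone 0 j 1 1 pos pos h) h3
  obtain ⟨ε₁, hε₁, ha, hb⟩ := hmatch 1
  obtain ⟨ε₂, hε₂, hc, hd⟩ := hmatch 2
  have he : ¬ Separated r (D 1 ε₁) (D 2 ε₂) :=
    htri 0 1 2 (-1) ε₁ ε₂ neg hε₁ hε₂ (hone' 0 1 1 ε₁ pos hε₁ ha) (hone' 0 2 1 ε₂ pos hε₂ hc)
  have hf : ¬ Separated r (D 1 (-ε₁)) (D 2 (-ε₂)) :=
    htri 0 1 2 1 (-ε₁) (-ε₂) pos (negs _ hε₁) (negs _ hε₂) (hone 0 1 1 ε₁ pos hε₁ ha)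
      (hone 0 2 1 ε₂ pos hε₂ hc)
  have hclique : ∀ (s : Fin 3 → ℤ), (∀ i, s i = 1 ∨ s i = -1) →
      ¬ Separated r (D 0 (s 0)) (D 1 (s 1)) → ¬ Separated r (D 0 (s 0)) (D 2 (s 2)) →
      ¬ Separated r (D 1 (s 1)) (D 2 (s 2)) → ∀ i j, i ≠ j → c ≤ s j * D i (s i) j := by
    intro s hs h01 h02 h12 i j hij
    refine hcoord i j _ _ (hs i) (hs j) ?_
    fin_cases i <;> fin_cases j <;>
      first
      | exact absurd rfl hij
      | assumption
      | exact fun g => h01 g.symm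
      | exact fun g => h02 g.symm
      | exact fun g => h12 g.symm
  have hs : ∀ i, (![1, ε₁, ε₂] : Fin 3 → ℤ) i = 1 ∨ (![1, ε₁, ε₂] : Fin 3 → ℤ) i = -1 := by
    intro i
    fin_cases i
    · exact pos
    · exact hε₁
    · exact hε₂
  refine ⟨![1, ε₁, ε₂], hs, hclique _ hs ha hc he, ?_⟩
  exact hclique (fun i => -(![1, ε₁, ε₂] : Fin 3 → ℤ) i) (fun i => negs _ (hs i)) hb hd hf

/-- Points at a common height in the cones of opposite sign patterns are separated when they do not
stray far into the opposite octant. -/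
lemma sep_of_opposite_signs {r L c : ℤ} {s : Fin 3 → ℤ} (hs : ∀ i, s i = 1 ∨ s i = -1)
    {p q : Fin 3 → Fin 3 → ℤ} (hp : ∀ i, AtHeight i (s i) L (p i))
    (hq : ∀ i, AtHeight i (-s i) L (q i)) (hc : ∀ i j, i ≠ j → -c ≤ s j * p i j)
    (hL : 2 * r + c < L) (hLr : r < L) (i j : Fin 3) :
    Separated r (p i) (q j) := by
  by_cases hij : i = j
  · subst hij
    exact (hp i).sep_opposite (hs i) (hq i) hLr
  · refine sep_of_sign (hs j) j ?_
    have h1 := (hq j).2.1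
    have h2 := hc i j hij
    rw [neg_mul] at h1
    omega

/-- Two triples of points in opposite octants contribute the separated points of both. -/
lemma packs_of_triples {S : Set (Fin 3 → ℤ)} {r L c : ℤ} {s : Fin 3 → ℤ} {k l : ℕ}
    (hs : ∀ i, s i = 1 ∨ s i = -1)
    {p q : Fin 3 → Fin 3 → ℤ} (hpS : ∀ i, p i ∈ S) (hqS : ∀ i, q i ∈ S)
    (hp : ∀ i, AtHeight i (s i) L (p i))
    (hq : ∀ i, AtHeight i (-s i) L (q i)) (hc : ∀ i j, i ≠ j → -c ≤ s j * p i j)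
    (hr : 0 ≤ r) (hL : 2 * r + c < L) (hLr : r < L)
    (hk : Packs r (Set.range p) k) (hl : Packs r (Set.range q) l) :
    Packs r (shell S L (L + 1)) (k + l) := by
  have hns : ∀ i, -s i = 1 ∨ -s i = -1 := fun i => by have := hs i; omega
  refine (hk.union hr hl ?_).mono ?_
  · rintro _ ⟨i, rfl⟩ _ ⟨j, rfl⟩
    exact sep_of_opposite_signs hs hp hq hc hL hLr i j
  · rintro _ (⟨i, rfl⟩ | ⟨i, rfl⟩)
    · exact (hp i).mem_shell (hs i) (hpS i)
    · exact (hq i).mem_shell (hns i) (hqS i)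

/-- If the three points at height `27t + 3` are pairwise close, then continuing the walks spreads
them apart at height `32t + 7`. -/
lemma packs_three_of_clique {t : ℤ} (ht : 1 ≤ t) {s : Fin 3 → ℤ} (hs : ∀ i, s i = 1 ∨ s i = -1)
    {E F : Fin 3 → Fin 3 → ℤ} (hE : ∀ i, AtHeight i (s i) (27 * t + 3) (E i))
    (hF : ∀ i, AtHeight i (s i) (32 * t + 7) (F i))
    (hEF : ∀ i, InCone i (s i) (F i - E i))
    (hcl : ∀ i j, i ≠ j → ¬ Separated (9 * t) (E i) (E j)) :
    Packs (4 * t) (Set.range F) 3 := by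
  have hsep : ∀ i j k, i ≠ j → i ≠ k → j ≠ k → Separated (4 * t) (F i) (F j) := by
    intro i j k hij hik hjk
    refine Separated.symm (sep_of_sign (hs j) j ?_)
    have h1 := le_of_not_sep (hs k) (hcl k i hik.symm) k
    have h2 := (hE k).2.1
    have h3 := (hE i).2
    have h4 := (hF j).2.1
    have h5 := (hF i).2.2
    have h6 := (hEF i).abs_le (hs i) (hs j) j
    have h7 : s j * E i j + s k * E i k ≤ s i * E i i :=
      (hE i).1.add_le (hs i) (hs j) (hs k) hij hik hjk
    simp only [Pi.sub_apply, mul_sub] at h6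
    omega
  exact packs_triple (by omega) ⟨0, rfl⟩ ⟨1, rfl⟩ ⟨2, rfl⟩
    (hsep 0 1 2 (by decide) (by decide) (by decide))
    (hsep 0 2 1 (by decide) (by decide) (by decide))
    (hsep 1 2 0 (by decide) (by decide) (by decide))

lemma packs_range_two {r L : ℤ} (hr : 0 ≤ r) {s : Fin 3 → ℤ} (hs : ∀ i, s i = 1 ∨ s i = -1)
    {q : Fin 3 → Fin 3 → ℤ} (hq : ∀ i, AtHeight i (s i) L (q i)) (hL : 4 * r + 1 < L) :
    Packs r (Set.range q) 2 := by
  obtain ⟨i, j, -, h⟩ := exists_sep_of_atHeight hs hq hL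
  exact packs_pair hr ⟨i, rfl⟩ ⟨j, rfl⟩ h

/-- A set closed under cone walks contains many separated points at one of three scales. -/
lemma exists_packs {t : ℤ} (ht : 1 ≤ t) {S : Set (Fin 3 → ℤ)} (h0 : 0 ∈ S)
    (walk : ∀ i s, (s = 1 ∨ s = -1) → ∀ T, T ≤ 32 * t + 7 → ∀ p ∈ S, InCone i s p →
      s * p i ≤ T + 1 → ∃ q ∈ S, InCone i s (q - p) ∧ T ≤ s * q i ∧ s * q i ≤ T + 1) :
    Packs (12 * t) (shell S 0 (24 * t + 6)) 4 ∨ Packs (9 * t) (shell S 0 (27 * t + 4)) 6 ∨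
      Packs (4 * t) (shell S 0 (32 * t + 8)) 16 := by
  have climb : ∀ T L, T ≤ 32 * t + 7 → L ≤ T → ∀ P : Fin 3 → ℤ → Fin 3 → ℤ,
      (∀ i s, s = 1 ∨ s = -1 → P i s ∈ S) →
      (∀ i s, s = 1 ∨ s = -1 → AtHeight i s L (P i s)) →
      ∃ Q : Fin 3 → ℤ → Fin 3 → ℤ, (∀ i s, s = 1 ∨ s = -1 → Q i s ∈ S) ∧
        (∀ i s, s = 1 ∨ s = -1 → AtHeight i s T (Q i s)) ∧
        (∀ i s, s = 1 ∨ s = -1 → InCone i s (Q i s - P i s)) := by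
    intro T L hT hLT P hPS hP
    have : ∀ i s, ∃ q, (s = 1 ∨ s = -1) → q ∈ S ∧ AtHeight i s T q ∧ InCone i s (q - P i s) := by
      intro i s
      by_cases hs : s = 1 ∨ s = -1
      · obtain ⟨q, hq, hc, hT⟩ := walk i s hs T hT (P i s) (hPS i s hs) (hP i s hs).1
          (by have := (hP i s hs).2.2; omega)
        refine ⟨q, fun _ => ⟨hq, ⟨?_, hT⟩, hc⟩⟩
        have := (hP i s hs).1.add hc
        rwa [add_sub_cancel] at this
      · exact ⟨0, fun h => absurd h hs⟩
    choose Q hQ using this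
    exact ⟨Q, fun i s hs => (hQ i s hs).1, fun i s hs => (hQ i s hs).2.1,
      fun i s hs => (hQ i s hs).2.2⟩
  have pos : (1 : ℤ) = 1 ∨ (1 : ℤ) = -1 := Or.inl rfl
  have neg : (-1 : ℤ) = 1 ∨ (-1 : ℤ) = -1 := Or.inr rfl
  have hzero : ∀ (i : Fin 3) (s : ℤ), s = 1 ∨ s = -1 → AtHeight i s 0 0 := by
    intro i s _
    simp [AtHeight, InCone]
  obtain ⟨A, hAS, hA, -⟩ := climb (8 * t + 1) 0 (by omega) (by omega) (fun _ _ => 0)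
    (fun _ _ _ => h0) hzero
  obtain ⟨B, hBS, hB, -⟩ := climb (9 * t + 1) 0 (by omega) (by omega) (fun _ _ => 0)
    (fun _ _ _ => h0) hzero
  obtain ⟨C, hCS, hC, -⟩ := climb (16 * t + 3) 0 (by omega) (by omega) (fun _ _ => 0)
    (fun _ _ _ => h0) hzero
  obtain ⟨D, hDS, hD, hCD⟩ := climb (24 * t + 5) _ (by omega) (by omega) C hCS hC
  obtain ⟨E, hES, hE, hDE⟩ := climb (27 * t + 3) _ (by omega) (by omega) D hDS hD
  obtain ⟨F, hFS, hF, hEF⟩ := climb (32 * t + 7) _ (by omega) (by omega) E hES hE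
  have center : ∀ r : ℤ, Packs r (shell S 0 0) 1 := fun r =>
    (packs_singleton r 0).mono (by rintro x rfl; exact ⟨h0, by simp [supNorm]⟩)
  by_cases hbad : Packs (12 * t) (shell S (24 * t + 5) (24 * t + 5 + 1)) 3
  · left
    have := (center (12 * t)).union_shell (by omega) hbad (by omega) (by omega) (by omega)
    rwa [show 24 * t + 5 + 1 = 24 * t + 6 by ring] at this
  right
  obtain ⟨s, hs, hsp, hsn⟩ :=
    exists_signs (c := 5) (by omega) (by norm_num) (by omega) hDS hD hbad
  have hs' : ∀ i, -s i = 1 ∨ -s i = -1 := fun i => by have := hs i; omega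
  have hDc : ∀ i j, i ≠ j → -(0 : ℤ) ≤ s j * D i (s i) j := fun i j hij => by
    have := hsp i j hij; omega
  have hCc : ∀ i j, i ≠ j → -(8 * t) ≤ s j * C i (s i) j := fun i j hij => by
    have h1 := hsp i j hij
    have h2 := (hCD i _ (hs i)).abs_le (hs i) (hs j) j
    have h3 := (hC i _ (hs i)).2
    have h4 := (hD i _ (hs i)).2
    simp only [Pi.sub_apply, mul_sub] at h2
    omega
  have hEc : ∀ i j, i ≠ j → -(3 * t) ≤ s j * E i (s i) j := fun i j hij => by
    have h1 := hsp i j hij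
    have h2 := (hDE i _ (hs i)).abs_le (hs i) (hs' j) j
    have h3 := (hD i _ (hs i)).2
    have h4 := (hE i _ (hs i)).2
    simp only [Pi.sub_apply, mul_sub, neg_mul] at h2
    omega
  have hFc : ∀ i j, i ≠ j → -(8 * t) ≤ s j * F i (s i) j := fun i j hij => by
    have h1 := hsp i j hij
    have h2 := (hDE i _ (hs i)).abs_le (hs i) (hs' j) j
    have h3 := (hD i _ (hs i)).2
    have h4 := (hF i _ (hs i)).2
    have h5 := (hEF i _ (hs i)).abs_le (hs i) (hs' j) j
    simp only [Pi.sub_apply, mul_sub, neg_mul] at h2 h5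
    omega
  have hr : 0 ≤ 4 * t := by omega
  by_cases hcl : (∃ i j, i ≠ j ∧ Separated (9 * t) (E i (s i)) (E j (s j))) ∧
      (∃ i j, i ≠ j ∧ Separated (9 * t) (E i (-s i)) (E j (-s j)))
  · left
    obtain ⟨⟨i, j, -, hij⟩, ⟨k, l, -, hkl⟩⟩ := hcl
    have hr9 : 0 ≤ 9 * t := by omega
    have h1 : Packs (9 * t) (shell S (9 * t + 1) (9 * t + 1 + 1)) 2 :=
      packs_pair hr9 ((hB 0 1 pos).mem_shell pos (hBS 0 1 pos))
        ((hB 0 (-1) neg).mem_shell neg (hBS 0 (-1) neg))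
        ((hB 0 1 pos).sep_opposite pos (hB 0 (-1) neg) (by omega))
    have h2 : Packs (9 * t) (shell S (27 * t + 3) (27 * t + 3 + 1)) (2 + 2) :=
      packs_of_triples (c := 3 * t) hs (fun i => hES i _ (hs i)) (fun i => hES i _ (hs' i))
        (fun i => hE i _ (hs i)) (fun i => hE i _ (hs' i)) hEc hr9 (by omega) (by omega)
        (packs_pair hr9 ⟨i, rfl⟩ ⟨j, rfl⟩ hij) (packs_pair hr9 ⟨k, rfl⟩ ⟨l, rfl⟩ hkl)
    refine (h1.union_shell hr9 h2 (by omega) (by omega) (by omega)).mono ?_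
    rintro x ⟨hx, hx1, hx2⟩
    exact ⟨hx, by omega, by omega⟩
  · right
    have hAp : Packs (4 * t) (shell S (8 * t + 1) (8 * t + 1 + 1)) 2 :=
      packs_pair hr ((hA 0 1 pos).mem_shell pos (hAS 0 1 pos))
        ((hA 0 (-1) neg).mem_shell neg (hAS 0 (-1) neg))
        ((hA 0 1 pos).sep_opposite pos (hA 0 (-1) neg) (by omega))
    have hCp : Packs (4 * t) (shell S (16 * t + 3) (16 * t + 3 + 1)) (2 + 2) :=
      packs_of_triples (c := 8 * t) hs (fun i => hCS i _ (hs i)) (fun i => hCS i _ (hs' i))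
        (fun i => hC i _ (hs i)) (fun i => hC i _ (hs' i)) hCc hr (by omega) (by omega)
        (packs_range_two hr hs (fun i => hC i _ (hs i)) (by omega))
        (packs_range_two hr hs' (fun i => hC i _ (hs' i)) (by omega))
    have hDp : Packs (4 * t) (shell S (24 * t + 5) (24 * t + 5 + 1)) (2 + 2) :=
      packs_of_triples (c := 0) hs (fun i => hDS i _ (hs i)) (fun i => hDS i _ (hs' i))
        (fun i => hD i _ (hs i)) (fun i => hD i _ (hs' i)) hDc hr (by omega) (by omega)
        (packs_range_two hr hs (fun i => hD i _ (hs i)) (by omega))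
        (packs_range_two hr hs' (fun i => hD i _ (hs' i)) (by omega))
    have hFp : Packs (4 * t) (shell S (32 * t + 7) (32 * t + 7 + 1)) 5 := by
      rw [not_and_or] at hcl
      push Not at hcl
      have h2 := packs_range_two hr hs (fun i => hF i _ (hs i)) (by omega)
      have h2' := packs_range_two hr hs' (fun i => hF i _ (hs' i)) (by omega)
      have key : ∀ k l, Packs (4 * t) (Set.range fun i => F i (s i)) k →
          Packs (4 * t) (Set.range fun i => F i (-s i)) l →
          Packs (4 * t) (shell S (32 * t + 7) (32 * t + 7 + 1)) (k + l) := fun k l hk hl =>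
        packs_of_triples (c := 8 * t) hs (fun i => hFS i _ (hs i)) (fun i => hFS i _ (hs' i))
          (fun i => hF i _ (hs i)) (fun i => hF i _ (hs' i)) hFc hr (by omega)
          (by omega) hk hl
      rcases hcl with hcl | hcl
      · exact key 3 2 (packs_three_of_clique ht hs (fun i => hE i _ (hs i))
          (fun i => hF i _ (hs i)) (fun i => hEF i _ (hs i)) hcl) h2'
      · exact key 2 3 h2 (packs_three_of_clique ht hs' (fun i => hE i _ (hs' i))
          (fun i => hF i _ (hs' i)) (fun i => hEF i _ (hs' i)) hcl)
    have h1 := (center (4 * t)).union_shell hr hAp (by omega) (by omega) (by omega)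
    have h2 := h1.union_shell hr hCp (by omega) (by omega) (by omega)
    have h3 := h2.union_shell hr hDp (by omega) (by omega) (by omega)
    have h4 := h3.union_shell hr hFp (by omega) (by omega) (by omega)
    rwa [show 32 * t + 7 + 1 = 32 * t + 8 by ring] at h4


/-- Points whose value of `u` decays at most exponentially in the sup norm. -/
def slowDecay (K : ℝ) (u : (Fin 3 → ℤ) → ℝ) : Set (Fin 3 → ℤ) :=
  {q | (K + 11) ^ (-supNorm q) * |u 0| ≤ |u q|}

lemma abs_lt_of_neighbors {K : ℝ} {u V : (Fin 3 → ℤ) → ℝ} {c : Fin 3 → ℤ} (hK : 0 < K)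
    (hu : discLap u c = V c * u c) (hV : |V c| ≤ K) {i : Fin 3} {s : ℤ} (hs : s = 1 ∨ s = -1)
    {x : ℝ} (hc : |u c| < x) (hi : |u (c + s • stdv i)| < x)
    (hj : ∀ j, j ≠ i → |u (c + stdv j)| < x ∧ |u (c - stdv j)| < x) :
    |u (c - s • stdv i)| < (K + 11) * x := by
  have hsum : |V c * u c| ≤ K * |u c| := by
    rw [abs_mul]
    exact mul_le_mul_of_nonneg_right hV (abs_nonneg _)
  have hKx : K * |u c| < K * x := mul_lt_mul_of_pos_left hc hK
  rw [← hu, abs_le] at hsum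
  unfold discLap at hsum
  rw [Fin.sum_univ_three] at hsum
  have hc' := abs_lt.1 hc
  have hi' := abs_lt.1 hi
  have h0 := hj 0
  have h1 := hj 1
  have h2 := hj 2
  simp only [abs_lt] at h0 h1 h2
  rw [abs_lt]
  fin_cases i <;> rcases hs with rfl | rfl <;>
    simp only [Fin.zero_eta, Fin.mk_one, Fin.reduceFinMk, ne_eq, not_true_eq_false, one_smul,
      neg_smul, sub_neg_eq_add, ← sub_eq_add_neg, not_false_eq_true, forall_true_left,
      Fin.reduceEq, zero_ne_one, one_ne_zero] at * <;>
    constructor <;> linarith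

/-- One step of the cone walk. -/
lemma exists_step {K : ℝ} {u V : (Fin 3 → ℤ) → ℝ} (hK : 0 < K) {i : Fin 3} {s : ℤ}
    (hs : s = 1 ∨ s = -1) {p : Fin 3 → ℤ}
    (hu : discLap u (p + s • stdv i) = V (p + s • stdv i) * u (p + s • stdv i))
    (hV : |V (p + s • stdv i)| ≤ K) :
    ∃ v, InCone i s v ∧ 1 ≤ s * v i ∧ s * v i ≤ 2 ∧ (K + 11)⁻¹ * |u p| ≤ |u (p + v)| := by
  by_contra! hn
  have key := abs_lt_of_neighbors (i := i) (x := (K + 11)⁻¹ * |u p|) hK hu hV hs ?_ ?_ ?_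
  · rw [add_sub_cancel_right, mul_inv_cancel_left₀ (by positivity)] at key
    exact lt_irrefl _ key
  · apply hn
    · unfold InCone
      fin_cases i <;> rcases hs with rfl | rfl <;> simp [stdv]
    all_goals rcases hs with rfl | rfl <;> simp [stdv]
  · rw [add_assoc]
    apply hn
    · unfold InCone
      fin_cases i <;> rcases hs with rfl | rfl <;> simp [stdv]
    all_goals rcases hs with rfl | rfl <;> simp [stdv]
  · intro j hj
    rw [add_assoc, add_sub_assoc]
    constructor <;> apply hn
    · unfold InCone
      fin_cases i <;> fin_cases j <;> rcases hs with rfl | rfl <;> simp [stdv] at hj ⊢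
    · rcases hs with rfl | rfl <;> simp [stdv, hj.symm]
    · rcases hs with rfl | rfl <;> simp [stdv, hj.symm]
    · unfold InCone
      fin_cases i <;> fin_cases j <;> rcases hs with rfl | rfl <;> simp [stdv] at hj ⊢
    · rcases hs with rfl | rfl <;> simp [stdv, hj.symm]
    · rcases hs with rfl | rfl <;> simp [stdv, hj.symm]

/-- The cone property: from a point of slow decay one can walk inside the cone in any axis direction
up to any height. -/
lemma exists_walk {K : ℝ} {u V : (Fin 3 → ℤ) → ℝ} {n : ℕ} (hK : 0 < K)
    (hu : ∀ a ∈ cube 0 (n : ℝ), discLap u a = V a * u a) (hV : ∀ a, |V a| ≤ K) {i : Fin 3}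
    {s : ℤ} (hs : s = 1 ∨ s = -1) {T : ℤ} (hT : T ≤ n) {p : Fin 3 → ℤ} (hp : p ∈ slowDecay K u)
    (hpc : InCone i s p) (hpT : s * p i ≤ T + 1) :
    ∃ q ∈ slowDecay K u, InCone i s (q - p) ∧ T ≤ s * q i ∧ s * q i ≤ T + 1 := by
  obtain ⟨k, hk⟩ : ∃ k : ℕ, T - s * p i ≤ k := ⟨(T - s * p i).toNat, Int.self_le_toNat _⟩
  induction k generalizing p with
  | zero =>
    exact ⟨p, hp, by simp [InCone], by push_cast at hk; omega, hpT⟩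
  | succ k ih =>
    by_cases hle : T ≤ s * p i
    · exact ⟨p, hp, by simp [InCone], hle, hpT⟩
    have hmem : p + s • stdv i ∈ cube 0 (n : ℝ) := by
      intro j
      have h1 := hpc.abs_le hs (Or.inl rfl) j
      have h2 := hpc.abs_le hs (Or.inr rfl) j
      have h3 : |(p + s • stdv i) j - (0 : Fin 3 → ℤ) j| ≤ (n : ℤ) := by
        rw [abs_le]
        by_cases hj : j = i
        · subst hj
          rcases hs with rfl | rfl <;> simp [stdv] <;> omega
        · simp [stdv, hj]
          omega
      exact_mod_cast h3
    obtain ⟨v, hv, hv1, hv2, hv3⟩ := exists_step hK hs (hu _ hmem) (hV _)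
    have hvc := hpc.add hv
    have hq : p + v ∈ slowDecay K u := by
      have hp' : (K + 11) ^ (-supNorm p) * |u 0| ≤ |u p| := hp
      change (K + 11) ^ (-supNorm (p + v)) * |u 0| ≤ |u (p + v)|
      refine le_trans ?_ hv3
      refine le_trans ?_ (mul_le_mul_of_nonneg_left hp' (by positivity))
      rw [← mul_assoc, ← zpow_neg_one, ← zpow_add₀ (by positivity)]
      refine mul_le_mul_of_nonneg_right (zpow_le_zpow_right₀ (by linarith) ?_) (abs_nonneg _)
      rw [hpc.supNorm_eq hs, hvc.supNorm_eq hs, Pi.add_apply, mul_add]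
      omega
    have hi : s * (p + v) i = s * p i + s * v i := by rw [Pi.add_apply, mul_add]
    obtain ⟨q, hq1, hq2, hq3⟩ := ih hq hvc (by omega) (by push_cast at hk; omega)
    refine ⟨q, hq1, ?_, hq3⟩
    have := hv.add hq2
    rwa [show v + (q - (p + v)) = q - p by abel] at this

lemma mem_cube_iff {a b : Fin 3 → ℤ} {r : ℕ} : b ∈ cube a (r : ℝ) ↔ ∀ i, |b i - a i| ≤ (r : ℤ) := by
  unfold cube
  refine forall_congr' fun i => ?_
  exact_mod_cast Iff.rfl

/-- The set `Θ` has the required properties, apart from being large. -/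
def IsPacking (m n : ℕ) (K : ℝ) (u : (Fin 3 → ℤ) → ℝ) (Θ : Finset (Fin 3 → ℤ)) : Prop :=
  (↑Θ : Set (Fin 3 → ℤ)) ⊆ cube 0 (n : ℝ) ∧
    (∀ b ∈ Θ, (K + 11) ^ (-(12 * (n : ℤ))) * |u 0| ≤ |u b|) ∧
    (∀ b ∈ Θ, ∀ b' ∈ Θ, b ≠ b' → cube b (m : ℝ) ∩ cube b' (m : ℝ) = ∅) ∧
    (∀ b ∈ Θ, cube b (m : ℝ) ⊆ cube 0 (n : ℝ))

lemma cube_add_subset {m r : ℕ} {a b : Fin 3 → ℤ} (h : cube b (m : ℝ) ⊆ cube 0 (r : ℝ)) :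
    cube (b + a) (m : ℝ) ⊆ cube a (r : ℝ) := by
  intro x hx
  rw [mem_cube_iff] at hx ⊢
  have := h (a := x - a) (by
    rw [mem_cube_iff]
    intro i
    have := hx i
    rwa [Pi.add_apply, add_comm, ← sub_sub] at this)
  rw [mem_cube_iff] at this
  intro i
  simpa using this i

/-- Gluing packings of small cubes around separated centres. -/
lemma exists_packing_of_packs {m n r k : ℕ} {L : ℤ} {K c : ℝ} {u : (Fin 3 → ℤ) → ℝ}
    (hK : 0 < K) (hc : 0 ≤ c) (hL : L + r ≤ n) (hr : L + 12 * r ≤ 12 * n)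
    (h : Packs r (shell (slowDecay K u) 0 L) k)
    (ih : ∀ b, cube b (r : ℝ) ⊆ cube 0 (n : ℝ) →
      ∃ Θ, IsPacking m r K (fun x => u (x + b)) Θ ∧ c ≤ (Θ.card : ℝ)) :
    ∃ Θ, IsPacking m n K u Θ ∧ k * c ≤ (Θ.card : ℝ) := by
  classical
  obtain ⟨Ξ, hΞ, hk, hsep⟩ := h
  have hcube : ∀ b ∈ Ξ, cube b (r : ℝ) ⊆ cube 0 (n : ℝ) := by
    intro b hb x hx
    rw [mem_cube_iff] at hx ⊢
    obtain ⟨-, -, hbL⟩ := hΞ hb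
    have h0 := hx 0
    have h1 := hx 1
    have h2 := hx 2
    unfold supNorm at hbL
    intro i
    rw [abs_le] at *
    rw [Pi.zero_apply]
    fin_cases i <;> simp only [Fin.zero_eta, Fin.mk_one, Fin.reduceFinMk] <;> omega
  have ih' : ∀ b, ∃ Θ, b ∈ Ξ → IsPacking m r K (fun x => u (x + b)) Θ ∧ c ≤ (Θ.card : ℝ) := by
    intro b
    by_cases hb : b ∈ Ξ
    · obtain ⟨Θ, hΘ⟩ := ih b (hcube b hb)
      exact ⟨Θ, fun _ => hΘ⟩
    · exact ⟨∅, fun h => absurd h hb⟩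
  choose Θ hΘ using ih'
  have hdisj : ∀ b ∈ Ξ, ∀ b' ∈ Ξ, b ≠ b' → Disjoint (cube b (r : ℝ)) (cube b' (r : ℝ)) := by
    intro b hb b' hb' hne
    rw [Set.disjoint_left]
    intro x hx hx'
    obtain ⟨i, hi⟩ := hsep b hb b' hb' hne
    rw [mem_cube_iff] at hx hx'
    have h1 := abs_le.1 (hx i)
    have h2 := abs_le.1 (hx' i)
    omega
  have hsub : ∀ b ∈ Ξ, ∀ y ∈ Θ b, y + b ∈ cube b (r : ℝ) := by
    intro b hb y hy
    have := (hΘ b hb).1.1 hy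
    rw [mem_cube_iff] at this ⊢
    simpa using this
  refine ⟨Ξ.biUnion fun b => (Θ b).image (· + b), ⟨?_, ?_, ?_, ?_⟩, ?_⟩
  · intro x hx
    simp only [Finset.coe_biUnion, Finset.coe_image, Set.mem_iUnion, Set.mem_image,
      Finset.mem_coe] at hx
    obtain ⟨b, hb, y, hy, rfl⟩ := hx
    exact hcube b hb (hsub b hb y hy)
  · intro x hx
    simp only [Finset.mem_biUnion, Finset.mem_image] at hx
    obtain ⟨b, hb, y, hy, rfl⟩ := hx
    have h1 := (hΘ b hb).1.2.1 y hy
    obtain ⟨h2, -, h3⟩ := hΞ hb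
    have h2' : (K + 11) ^ (-supNorm b) * |u 0| ≤ |u b| := h2
    simp only [zero_add] at h1
    refine le_trans ?_ h1
    refine le_trans ?_ (mul_le_mul_of_nonneg_left h2' (by positivity))
    rw [← mul_assoc, ← zpow_add₀ (by positivity)]
    refine mul_le_mul_of_nonneg_right (zpow_le_zpow_right₀ (by linarith) ?_) (abs_nonneg _)
    omega
  · intro x hx x' hx' hne
    simp only [Finset.mem_biUnion, Finset.mem_image] at hx hx'
    obtain ⟨b, hb, y, hy, rfl⟩ := hx
    obtain ⟨b', hb', y', hy', rfl⟩ := hx'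
    by_cases hbb : b = b'
    · subst hbb
      have h1 := (hΘ b hb).1.2.2.1 y hy y' hy' (fun h => hne (by rw [h]))
      rw [← Set.disjoint_iff_inter_eq_empty, Set.disjoint_left] at h1 ⊢
      intro z hz hz'
      apply h1 (a := z - b)
      · rw [mem_cube_iff] at hz ⊢
        intro i
        have := hz i
        rwa [Pi.add_apply, add_comm, ← sub_sub] at this
      · rw [mem_cube_iff] at hz' ⊢
        intro i
        have := hz' i
        rwa [Pi.add_apply, add_comm, ← sub_sub] at this
    · rw [← Set.disjoint_iff_inter_eq_empty]
      exact (hdisj b hb b' hb' hbb).mono (cube_add_subset ((hΘ b hb).1.2.2.2 y hy))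
        (cube_add_subset ((hΘ b' hb').1.2.2.2 y' hy'))
  · intro x hx
    simp only [Finset.mem_biUnion, Finset.mem_image] at hx
    obtain ⟨b, hb, y, hy, rfl⟩ := hx
    exact (cube_add_subset ((hΘ b hb).1.2.2.2 y hy)).trans (hcube b hb)
  · rw [Finset.card_biUnion]
    · have h1 : ∀ b ∈ Ξ, c ≤ (((Θ b).image (· + b)).card : ℝ) := by
        intro b hb
        rw [Finset.card_image_of_injective _ (add_left_injective b)]
        exact (hΘ b hb).2
      have h2 := Finset.card_nsmul_le_sum Ξ _ c h1
      push_cast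
      refine le_trans ?_ h2
      rw [nsmul_eq_mul]
      exact mul_le_mul_of_nonneg_right (by exact_mod_cast hk) hc
    · intro b hb b' hb' hne
      rw [Function.onFun, Finset.disjoint_left]
      intro x hx hx'
      simp only [Finset.mem_image] at hx hx'
      obtain ⟨y, hy, rfl⟩ := hx
      obtain ⟨y', hy', he⟩ := hx'
      refine Set.disjoint_left.1 (hdisj b hb b' hb' hne) (hsub b hb y hy) ?_
      rw [← he]
      exact hsub b' hb' y' hy'

lemma rpow_ratio_le {m n r : ℕ} {q k : ℝ} (hm : 0 < m) (hr : 0 < r) (hq : 0 ≤ q)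
    (hn : (n : ℝ) ≤ q * r) (hk : 0 ≤ k) (hqk : q ^ 64 ≤ k ^ 51) :
    ((n : ℝ) / m) ^ (64 / 51 : ℝ) ≤ k * ((r : ℝ) / m) ^ (64 / 51 : ℝ) := by
  have hm' : (0 : ℝ) < m := by exact_mod_cast hm
  have h1 : (n : ℝ) / m ≤ q * (r / m) := by
    rw [← mul_div_assoc]
    exact div_le_div_of_nonneg_right hn hm'.le
  have h2 : q ^ (64 / 51 : ℝ) ≤ k := by
    refine le_of_pow_le_pow_left₀ (n := 51) (by norm_num) hk (le_of_eq_of_le ?_ hqk)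
    rw [← Real.rpow_mul_natCast hq, ← Real.rpow_natCast]
    norm_num
  calc ((n : ℝ) / m) ^ (64 / 51 : ℝ) ≤ (q * (r / m)) ^ (64 / 51 : ℝ) :=
        Real.rpow_le_rpow (by positivity) h1 (by norm_num)
    _ = q ^ (64 / 51 : ℝ) * ((r : ℝ) / m) ^ (64 / 51 : ℝ) :=
        Real.mul_rpow hq (by positivity)
    _ ≤ _ := mul_le_mul_of_nonneg_right h2 (by positivity)

lemma discLap_translate (u : (Fin 3 → ℤ) → ℝ) (a b : Fin 3 → ℤ) :
    discLap (fun x => u (x + b)) a = discLap u (a + b) := by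
  unfold discLap
  simp only [add_right_comm a _ b, sub_add_eq_add_sub]

lemma exists_large_packing (n : ℕ) : ∀ m : ℕ, 0 < m → m ≤ n → ∀ K : ℝ, 0 < K →
    ∀ u V : (Fin 3 → ℤ) → ℝ, (∀ a ∈ cube 0 (n : ℝ), discLap u a = V a * u a) →
      (∀ a, |V a| ≤ K) →
      ∃ Θ, IsPacking m n K u Θ ∧
        (20000 ^ (64 / 51 : ℝ))⁻¹ * ((n : ℝ) / m) ^ (64 / 51 : ℝ) ≤ (Θ.card : ℝ) := by
  induction n using Nat.strong_induction_on with
  | _ n ih =>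
  intro m hm hmn K hK u V hu hV
  have hm' : (0 : ℝ) < m := by exact_mod_cast hm
  by_cases hsmall : n ≤ 20000 * m
  · refine ⟨{0}, ⟨?_, ?_, ?_, ?_⟩, ?_⟩
    · intro x hx
      rw [Finset.coe_singleton, Set.mem_singleton_iff] at hx
      subst hx
      rw [mem_cube_iff]
      simp
    · intro b hb
      rw [Finset.mem_singleton] at hb
      subst hb
      refine mul_le_of_le_one_left (abs_nonneg _) ?_
      exact zpow_le_one_of_nonpos₀ (by linarith) (by omega)
    · simp
    · intro b hb x hx
      rw [Finset.mem_singleton] at hb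
      subst hb
      rw [mem_cube_iff] at hx ⊢
      intro i
      exact (hx i).trans (by exact_mod_cast hmn)
    · rw [Finset.card_singleton, Nat.cast_one, inv_mul_le_iff₀ (by positivity), mul_one]
      refine Real.rpow_le_rpow (by positivity) ?_ (by norm_num)
      rw [div_le_iff₀ hm']
      exact_mod_cast hsmall
  · push Not at hsmall
    obtain ⟨t, ht1, ht2⟩ : ∃ t : ℕ, 36 * t + 8 ≤ n ∧ n < 36 * t + 44 :=
      ⟨(n - 8) / 36, by omega, by omega⟩
    have ht : 500 * m ≤ t := by omega
    have hnt : (n : ℝ) ≤ 36 * t + 44 := by exact_mod_cast ht2.le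
    have htR : (500 : ℝ) ≤ t := by
      have : 500 ≤ t := by omega
      exact_mod_cast this
    have step : ∀ (r k : ℕ) (L : ℤ) (q : ℝ), 0 < r → m ≤ r → r < n → L + r ≤ n →
        L + 12 * r ≤ 12 * n → 0 ≤ q → (n : ℝ) ≤ q * r → q ^ 64 ≤ (k : ℝ) ^ 51 →
        Packs r (shell (slowDecay K u) 0 L) k →
        ∃ Θ, IsPacking m n K u Θ ∧
          (20000 ^ (64 / 51 : ℝ))⁻¹ * ((n : ℝ) / m) ^ (64 / 51 : ℝ) ≤ (Θ.card : ℝ) := by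
      intro r k L q hr hmr hrn hL hL' hq hnq hqk hp
      obtain ⟨Θ, h1, h2⟩ := exists_packing_of_packs (m := m)
        (c := (20000 ^ (64 / 51 : ℝ))⁻¹ * ((r : ℝ) / m) ^ (64 / 51 : ℝ)) hK (by positivity)
        hL hL' hp (by
          intro b hb
          refine ih r hrn m hm hmr K hK _ (fun x => V (x + b)) ?_ (fun a => hV _)
          intro a ha
          rw [discLap_translate]
          refine hu _ (hb ?_)
          rw [mem_cube_iff] at ha ⊢
          simpa using ha)
      refine ⟨Θ, h1, le_trans ?_ h2⟩
      rw [mul_left_comm]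
      exact mul_le_mul_of_nonneg_left (rpow_ratio_le hm hr hq hnq (by positivity) hqk)
        (by positivity)
    have hwalk := exists_packs (t := t) (S := slowDecay K u) (by omega)
      (by simp [slowDecay, supNorm])
      (fun i s hs T hT p hp hc hpT => exists_walk hK hu hV hs (by omega) hp hc hpT)
    rcases hwalk with h | h | h
    · exact step (12 * t) 4 (24 * t + 6) (301 / 100) (by omega) (by omega) (by omega)
        (by push_cast; omega) (by push_cast; omega) (by norm_num) (by push_cast; linarith)
        (by norm_num) (by exact_mod_cast h)
    · exact step (9 * t) 6 (27 * t + 4) (401 / 100) (by omega) (by omega) (by omega)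
        (by push_cast; omega) (by push_cast; omega) (by norm_num) (by push_cast; linarith)
        (by norm_num) (by exact_mod_cast h)
    · exact step (4 * t) 16 (32 * t + 8) (903 / 100) (by omega) (by omega) (by omega)
        (by push_cast; omega) (by push_cast; omega) (by norm_num) (by push_cast; linarith)
        (by norm_num) (by exact_mod_cast h)

/-- Recursive lower bound: at least `β (n/m)^α` points of `Q_n`, with `α > 5/4`,
carrying disjoint `2m`-cubes inside `Q_n`, at which `|u| ≥ (K+11)^{-12n} |u(0)|`. -/
theorem many_disjoint_subcubes :
    ∃ β : ℝ, 0 < β ∧ ∃ α : ℝ, 5 / 4 < α ∧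
      ∀ m n : ℕ, 0 < m → m ≤ n →
        ∀ K : ℝ, 0 < K →
          ∀ u V : (Fin 3 → ℤ) → ℝ,
            (∀ a ∈ cube 0 (n : ℝ), discLap u a = V a * u a) →
            (∀ a, |V a| ≤ K) →
            ∃ Θ : Finset (Fin 3 → ℤ),
              (↑Θ : Set (Fin 3 → ℤ)) ⊆ cube 0 (n : ℝ) ∧
              β * ((n : ℝ) / (m : ℝ)) ^ α ≤ (Θ.card : ℝ) ∧
              (∀ b ∈ Θ, (K + 11) ^ (-(12 * (n : ℤ))) * |u 0| ≤ |u b|) ∧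
              (∀ b ∈ Θ, ∀ b' ∈ Θ, b ≠ b' → cube b (m : ℝ) ∩ cube b' (m : ℝ) = ∅) ∧
              (∀ b ∈ Θ, cube b (m : ℝ) ⊆ cube 0 (n : ℝ)) := by
  refine ⟨(20000 ^ (64 / 51 : ℝ))⁻¹, by positivity, 64 / 51, by norm_num, ?_⟩
  intro m n hm hmn K hK u V hu hV
  obtain ⟨Θ, ⟨h1, h2, h3, h4⟩, hcard⟩ := exists_large_packing n m hm hmn K hK u V hu hV
  exact ⟨Θ, h1, hcard, h2, h3, h4⟩
end
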